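/- arXiv:2111.04263 — 9 statements merged into one kernel-verified Lean document; each statement's English description precedes it below -/
import Mathlib

section
/- (One-round FedDyn descent, nonconvex case.) Assume α ≥ 20·L·(m/P). Set z = α²P² − 32L²m² + 16L²Pm − 20L²P², κ = 4L³P·((α + L)/α)·(2m − P)/z, and κ₀ = (1/(2α))·( α²P² − 4αLP² − 32L²m² − 16L²Pm − 24L²P² ) / z. Then E_𝒫[ ℓ(γ(𝒫)) ] + κ · E_𝒫[ D⁺(𝒫) ] ≤ ℓ(γ̄) + κ·D − κ₀·‖∇ℓ(γ̄)‖². -/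
open scoped RealInnerProductSpace

theorem aux_avg (m P : ℕ) (hP1 : 1 ≤ P) (hPm : P ≤ m) (f : Fin m → ℝ) :
    (P:ℝ)⁻¹ * ((∑ S ∈ Finset.powersetCard P (Finset.univ : Finset (Fin m)), ∑ k ∈ S, f k) /
      ((Finset.powersetCard P (Finset.univ : Finset (Fin m))).card : ℝ)) = (m:ℝ)⁻¹ * ∑ k, f k := by
  have hcount : ∀ k : Fin m, ((Finset.powersetCard P (Finset.univ : Finset (Fin m))).filter
      (fun S => k ∈ S)).card = (m-1).choose (P-1) := by
    intro k
    have : (Finset.powersetCard P (Finset.univ : Finset (Fin m))).filter (fun S => k ∈ S)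
        = (Finset.powersetCard (P-1) ((Finset.univ : Finset (Fin m)).erase k)).image (insert k) := by
      ext S
      simp only [Finset.mem_filter, Finset.mem_powersetCard, Finset.mem_image]
      constructor
      · rintro ⟨⟨-, h1⟩, h2⟩
        refine ⟨S.erase k, ⟨?_, ?_⟩, Finset.insert_erase h2⟩
        · exact Finset.erase_subset_erase _ (Finset.subset_univ _)
        · rw [Finset.card_erase_of_mem h2, h1]
      · rintro ⟨T, ⟨h1, h2⟩, rfl⟩
        have : k ∉ T := fun hk => by simpa using h1 hk
        refine ⟨⟨Finset.subset_univ _, ?_⟩, by simp⟩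
        rw [Finset.card_insert_of_notMem this]; omega
    rw [this, Finset.card_image_of_injOn, Finset.card_powersetCard, Finset.card_erase_of_mem (by simp)]
    · simp
    · intro S hS T hT h
      have hS' : k ∉ S := fun hk => by
        simpa using (Finset.mem_powersetCard.1 hS).1 hk
      have hT' : k ∉ T := fun hk => by
        simpa using (Finset.mem_powersetCard.1 hT).1 hk
      have := congrArg (fun U => Finset.erase U k) h
      simpa [Finset.erase_insert hS', Finset.erase_insert hT'] using this
  have h1 : ∑ S ∈ Finset.powersetCard P (Finset.univ : Finset (Fin m)), ∑ k ∈ S, f k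
      = ((m-1).choose (P-1) : ℝ) * ∑ k, f k := by
    have : ∀ S : Finset (Fin m), ∑ k ∈ S, f k = ∑ k, if k ∈ S then f k else 0 := by
      intro S; simp
    rw [Finset.sum_congr rfl (fun S _ => this S)]
    rw [Finset.sum_comm, Finset.mul_sum]
    refine Finset.sum_congr rfl fun k _ => ?_
    rw [← Finset.sum_filter, Finset.sum_const, hcount, nsmul_eq_mul]
  rw [h1, Finset.card_powersetCard, Finset.card_univ, Fintype.card_fin]
  have h2 : m * (m-1).choose (P-1) = m.choose P * P := by
    obtain ⟨a, rfl⟩ : ∃ a, m = a+1 := ⟨m-1, by omega⟩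
    obtain ⟨b, rfl⟩ : ∃ b, P = b+1 := ⟨P-1, by omega⟩
    exact Nat.add_one_mul_choose_eq a b
  have h3 : (m:ℝ) * ((m-1).choose (P-1) : ℝ) = (m.choose P : ℝ) * P := by exact_mod_cast h2
  have hm0 : (m:ℝ) ≠ 0 := by norm_cast; omega
  have hP0 : (P:ℝ) ≠ 0 := by norm_cast; omega
  have hc : (m.choose P : ℝ) ≠ 0 := by
    have := Nat.choose_pos hPm
    norm_cast; omega
  field_simp
  linear_combination (∑ k, f k) * h3

theorem aux_descent {E : Type*} [NormedAddCommGroup E] [InnerProductSpace ℝ E] [CompleteSpace E]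
    (f : E → ℝ) (L : ℝ) (hd : Differentiable ℝ f)
    (hs : ∀ x y, ‖gradient f x - gradient f y‖ ≤ L * ‖x - y‖) (x y : E) :
    f y ≤ f x + inner ℝ (gradient f x) (y - x) + L / 2 * ‖y - x‖ ^ 2 := by
  set v := y - x with hv
  have hder : ∀ t : ℝ, HasDerivAt (fun t : ℝ => f (x + t • v) - t * inner ℝ (gradient f x) v
      - L / 2 * ‖v‖ ^ 2 * t ^ 2)
      (inner ℝ (gradient f (x + t • v)) v - inner ℝ (gradient f x) v - L * ‖v‖ ^ 2 * t) t := by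
    intro t
    have h1 : HasFDerivAt f (InnerProductSpace.toDual ℝ E (gradient f (x + t • v))) (x + t • v) :=
      (hd _).hasGradientAt.hasFDerivAt
    have h2 : HasDerivAt (fun t : ℝ => x + t • v) v t := by
      simpa using ((hasDerivAt_id t).smul_const v).const_add x
    have h3 := h1.comp_hasDerivAt t h2
    have h4 := (h3.sub ((hasDerivAt_id t).mul_const (inner ℝ (gradient f x) v))).sub
      ((hasDerivAt_pow 2 t).const_mul (L / 2 * ‖v‖ ^ 2))
    have h5 := h4.congr_deriv (f' := _) (g' := inner ℝ (gradient f (x + t • v)) v -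
      inner ℝ (gradient f x) v - L * ‖v‖ ^ 2 * t) (by
        rw [InnerProductSpace.toDual_apply_apply]
        push_cast
        ring)
    exact h5
  have hanti := antitoneOn_of_deriv_nonpos (convex_Icc (0:ℝ) 1)
    (fun t _ => (hder t).continuousAt.continuousWithinAt)
    (fun t _ => (hder t).differentiableAt.differentiableWithinAt)
    (fun t ht => by
      rw [(hder t).deriv, ← inner_sub_left]
      rw [interior_Icc] at ht
      have h5 := real_inner_le_norm (gradient f (x + t • v) - gradient f x) v
      have h6 := hs (x + t • v) x
      rw [add_sub_cancel_left, norm_smul, Real.norm_of_nonneg ht.1.le] at h6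
      nlinarith [norm_nonneg v])
  have := hanti (Set.left_mem_Icc.2 zero_le_one) (Set.right_mem_Icc.2 zero_le_one) zero_le_one
  simp [hv] at this
  simp [hv]
  linarith

theorem aux_jensen {E ι : Type*} [NormedAddCommGroup E] [InnerProductSpace ℝ E]
    (S : Finset ι) (f : ι → E) (n : ℝ) (hn : n = S.card) (hpos : 0 < n) :
    ‖n⁻¹ • ∑ k ∈ S, f k‖ ^ 2 ≤ n⁻¹ * ∑ k ∈ S, ‖f k‖ ^ 2 := by
  have h1 : ‖∑ k ∈ S, f k‖ ^ 2 ≤ n * ∑ k ∈ S, ‖f k‖ ^ 2 := by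
    refine (pow_le_pow_left₀ (norm_nonneg _) (norm_sum_le _ _) 2).trans ?_
    rw [hn]; exact sq_sum_le_card_mul_sum_sq
  rw [norm_smul, mul_pow, norm_inv, Real.norm_of_nonneg hpos.le]
  calc _ ≤ n⁻¹ ^ 2 * (n * ∑ k ∈ S, ‖f k‖ ^ 2) := by gcongr
    _ = _ := by field_simp

theorem aux_var {E ι : Type*} [NormedAddCommGroup E] [InnerProductSpace ℝ E]
    (S : Finset ι) (f : ι → E) (n : ℝ) (hn : n = S.card) (hpos : 0 < n) (c : E)
    (hc : c = n⁻¹ • ∑ k ∈ S, f k) :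
    ∑ k ∈ S, ‖f k - c‖ ^ 2 ≤ ∑ k ∈ S, ‖f k‖ ^ 2 := by
  have h1 : ∑ k ∈ S, f k = n • c := by rw [hc, smul_smul, mul_inv_cancel₀ hpos.ne', one_smul]
  have : ∑ k ∈ S, ‖f k - c‖ ^ 2 = ∑ k ∈ S, ‖f k‖ ^ 2 - n * ‖c‖ ^ 2 := by
    simp_rw [norm_sub_sq_real]
    rw [Finset.sum_add_distrib, Finset.sum_sub_distrib, ← Finset.mul_sum, ← sum_inner, h1,
      Finset.sum_const, nsmul_eq_mul, ← hn, real_inner_smul_left, real_inner_self_eq_norm_sq]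
    ring
  rw [this]
  nlinarith [sq_nonneg ‖c‖]

theorem aux_three {E : Type*} [NormedAddCommGroup E] [InnerProductSpace ℝ E] (a b c : E) :
    ‖a + b + c‖ ^ 2 ≤ 3 * (‖a‖ ^ 2 + ‖b‖ ^ 2 + ‖c‖ ^ 2) := by
  have h := norm_add₃_le (a := a) (b := b) (c := c)
  have := pow_le_pow_left₀ (norm_nonneg _) h 2
  nlinarith [sq_nonneg (‖a‖ - ‖b‖), sq_nonneg (‖a‖ - ‖c‖), sq_nonneg (‖c‖ - ‖b‖)]

theorem aux_young {E : Type*} [NormedAddCommGroup E] [InnerProductSpace ℝ E] (x y : E) (c : ℝ)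
    (hc : 0 < c) :
    ‖x - y‖ ^ 2 ≤ (1 + c) * ‖x‖ ^ 2 + (1 + c⁻¹) * ‖y‖ ^ 2 := by
  have := pow_le_pow_left₀ (norm_nonneg _) (norm_sub_le x y) 2
  have h2 : 2 * ‖x‖ * ‖y‖ ≤ c * ‖x‖ ^ 2 + c⁻¹ * ‖y‖ ^ 2 := by
    have : c * ‖x‖ ^ 2 + c⁻¹ * ‖y‖ ^ 2 - 2 * ‖x‖ * ‖y‖ = c⁻¹ * (c * ‖x‖ - ‖y‖) ^ 2 := by
      field_simp
      ring
    have : 0 ≤ c⁻¹ * (c * ‖x‖ - ‖y‖) ^ 2 := by positivity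
    linarith
  nlinarith

set_option maxHeartbeats 1000000 in
theorem aux_arith (m P α L ε D G z κ κ₀ : ℝ) (hP1 : 1 ≤ P) (hPm : P ≤ m)
    (hα : 0 < α) (hL : 0 < L) (hαc : 20 * L * m ≤ α * P)
    (hε : 0 ≤ ε) (hD : 0 ≤ D) (hG : 0 ≤ G)
    (hz : z = α ^ 2 * P ^ 2 - 32 * L ^ 2 * m ^ 2 + 16 * L ^ 2 * P * m - 20 * L ^ 2 * P ^ 2)
    (hκ : κ = 4 * L ^ 3 * P * ((α + L) / α) * (2 * (m : ℝ) - P) / z)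
    (hκ₀ : κ₀ = 1 / (2 * α) * ((α ^ 2 * P ^ 2 - 4 * α * L * P ^ 2 - 32 * L ^ 2 * m ^ 2 -
      16 * L ^ 2 * P * m - 24 * L ^ 2 * P ^ 2) / z))
    (hII : α ^ 2 * ε ≤ 3 * (L ^ 2 * ε + L ^ 2 * D + G)) :
    0 ≤ κ ∧
    (L ^ 2 / (2 * α) + L / 2) * ε + κ * ((1 - P / (2 * m)) * D + (P / m + (2 * m - P) / P) * ε)
      ≤ κ * D + (1 / (2 * α) - κ₀) * G := by
  have hm : 0 < m := by linarith
  have hP : 0 < P := by linarith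
  have hmL : 0 < L * m := by positivity
  have hsq : 400 * L ^ 2 * m ^ 2 ≤ α ^ 2 * P ^ 2 := by nlinarith
  have hPm2 : P ^ 2 ≤ m ^ 2 := by nlinarith
  have hL2 : 0 < L ^ 2 := by positivity
  have hz0 : 0 < z := by
    rw [hz]
    have : L ^ 2 * P ^ 2 ≤ L ^ 2 * m ^ 2 := by gcongr
    have h3 : 0 < L ^ 2 * m ^ 2 := by positivity
    have h4 : 0 < L ^ 2 * P * m := by positivity
    nlinarith
  have h2m : 0 < 2 * m - P := by linarith
  have hκ0 : 0 < κ := by rw [hκ]; positivity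
  refine ⟨hκ0.le, ?_⟩
  set Q := α ^ 2 - 4 * L ^ 2 with hQ
  have hQ0 : 0 < Q := by
    have : 0 < P ^ 2 * Q := by
      have : L ^ 2 * P ^ 2 ≤ L ^ 2 * m ^ 2 := by gcongr
      have h3 : 0 < L ^ 2 * m ^ 2 := by positivity
      rw [hQ]; nlinarith
    exact pos_of_mul_pos_right this (by positivity)
  have hεQ : ε ≤ (4 * L ^ 2 * D + 4 * G) / Q := by
    rw [le_div_iff₀ hQ0, hQ]
    nlinarith [mul_nonneg hL2.le hε, mul_nonneg hL2.le hD]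
  set B := L ^ 2 / (2 * α) + L / 2 with hB
  have hBe : α * B = L * (α + L) / 2 := by rw [hB]; field_simp; ring
  have hB0 : 0 < B := by rw [hB]; positivity
  set A := P / m + (2 * m - P) / P with hA
  have hAe : m * P * A = 2 * m ^ 2 - m * P + P ^ 2 := by rw [hA]; field_simp; ring
  have hA0 : 0 < A := by rw [hA]; positivity
  have hzQ : z = P ^ 2 * Q - 16 * L ^ 2 * (m * P * A) := by rw [hAe, hz, hQ]; ring
  have hκz : κ * z = 8 * L ^ 2 * P * (2 * m - P) * B := by
    have : B = L * (α + L) / (2 * α) := by field_simp; linarith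
    rw [this, hκ]; field_simp; ring
  clear_value A B Q
  have h1 : (B + κ * A) * (4 * L ^ 2) / Q ≤ κ * (P / (2 * m)) := by
    rw [div_le_iff₀ hQ0]
    have e1 : 8 * L ^ 2 * P * m * B ≤ κ * z := by
      rw [hκz]; gcongr; linarith
    have e2 : 0 ≤ κ * (8 * L ^ 2 * (m * P * A)) := by positivity
    have e3 : 8 * L ^ 2 * P * m * B + κ * (8 * L ^ 2 * (m * P * A)) ≤ κ * (P ^ 2 * Q) := by
      rw [hzQ] at e1; nlinarith
    have : κ * (P / (2 * m)) * Q = κ * (P ^ 2 * Q) / (2 * m * P) := by field_simp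
    rw [this, le_div_iff₀ (by positivity)]
    nlinarith
  have h2 : (B + κ * A) * 4 / Q ≤ 1 / (2 * α) - κ₀ := by
    have e0 : 1 / (2 * α) - κ₀ = (4 * P ^ 2 * (α * B) + 16 * L ^ 2 * P * m) / (α * z) := by
      rw [hκ₀, hBe]; field_simp; rw [hz]; ring
    have e1 : κ * z ≤ 16 * L ^ 2 * P * m * B := by
      rw [hκz]
      have : 0 < L ^ 2 * P * P * B := by positivity
      linarith
    have e4 : (4 * P ^ 2 * B) / z ≤ 1 / (2 * α) - κ₀ := by
      rw [e0, div_le_div_iff₀ hz0 (by positivity)]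
      have : 0 < 16 * L ^ 2 * P * m * z := by positivity
      linarith
    refine le_trans ?_ e4
    rw [div_le_div_iff₀ hQ0 hz0]
    have : κ * z * A ≤ 16 * L ^ 2 * P * m * B * A := by gcongr
    have e5 : B * z = B * (P ^ 2 * Q - 16 * L ^ 2 * (m * P * A)) := by rw [hzQ]
    linarith
  have hc : 0 < B + κ * A := by positivity
  have h3 : (B + κ * A) * ε ≤ κ * (P / (2 * m)) * D + (1 / (2 * α) - κ₀) * G := by
    calc (B + κ * A) * ε ≤ (B + κ * A) * ((4 * L ^ 2 * D + 4 * G) / Q) := by gcongr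
      _ = ((B + κ * A) * (4 * L ^ 2) / Q) * D + ((B + κ * A) * 4 / Q) * G := by ring
      _ ≤ _ := by gcongr
  linarith

set_option maxHeartbeats 1000000 in
/-- one-round FedDyn descent, nonconvex case. -/
theorem one_round_descent_nonconvex
    (d m P : ℕ) (hd : 1 ≤ d) (hm : 1 ≤ m) (hP1 : 1 ≤ P) (hPm : P ≤ m)
    (α L : ℝ) (hα : 0 < α) (hL : 0 < L)
    (hαc : 20 * L * ((m : ℝ) / P) ≤ α)
    (Lk : Fin m → EuclideanSpace ℝ (Fin d) → ℝ)
    (hdiff : ∀ k, Differentiable ℝ (Lk k))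
    (hsmooth : ∀ k x y, ‖gradient (Lk k) x - gradient (Lk k) y‖ ≤ L * ‖x - y‖)
    (ℓ : EuclideanSpace ℝ (Fin d) → ℝ)
    (hℓ : ∀ θ, ℓ θ = (m : ℝ)⁻¹ * ∑ k, Lk k θ)
    (θbar : EuclideanSpace ℝ (Fin d))
    (θ' : Fin m → EuclideanSpace ℝ (Fin d))
    (h : EuclideanSpace ℝ (Fin d)) (hh : h = (m : ℝ)⁻¹ • ∑ k, gradient (Lk k) (θ' k))
    (γbar : EuclideanSpace ℝ (Fin d)) (hγbar : γbar = θbar + α⁻¹ • h)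
    (θt : Fin m → EuclideanSpace ℝ (Fin d))
    (hfoc : ∀ k, gradient (Lk k) (θt k) - gradient (Lk k) (θ' k) + α • (θt k - θbar) = 0)
    (z κ κ₀ : ℝ)
    (hz : z = α ^ 2 * P ^ 2 - 32 * L ^ 2 * m ^ 2 + 16 * L ^ 2 * P * m - 20 * L ^ 2 * P ^ 2)
    (hκ : κ = 4 * L ^ 3 * P * ((α + L) / α) * (2 * (m : ℝ) - P) / z)
    (hκ₀ : κ₀ = 1 / (2 * α) * ((α ^ 2 * P ^ 2 - 4 * α * L * P ^ 2 - 32 * L ^ 2 * m ^ 2 -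
      16 * L ^ 2 * P * m - 24 * L ^ 2 * P ^ 2) / z)) :
    (∑ S ∈ Finset.powersetCard P (Finset.univ : Finset (Fin m)),
        ℓ ((P : ℝ)⁻¹ • ∑ k ∈ S, θt k)) /
      ((Finset.powersetCard P (Finset.univ : Finset (Fin m))).card : ℝ) +
    κ * ((∑ S ∈ Finset.powersetCard P (Finset.univ : Finset (Fin m)),
        (m : ℝ)⁻¹ * ∑ k, ‖(if k ∈ S then θt k else θ' k) - (P : ℝ)⁻¹ • ∑ j ∈ S, θt j‖ ^ 2) /
      ((Finset.powersetCard P (Finset.univ : Finset (Fin m))).card : ℝ)) ≤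
    ℓ γbar + κ * ((m : ℝ)⁻¹ * ∑ k, ‖θ' k - γbar‖ ^ 2) -
      κ₀ * ‖gradient ℓ γbar‖ ^ 2 := by
  have hm0 : (0:ℝ) < m := by exact_mod_cast hm
  have hP0 : (0:ℝ) < P := by exact_mod_cast hP1
  have hPm' : (P:ℝ) ≤ m := by exact_mod_cast hPm
  have hcard : (m:ℝ) = ((Finset.univ : Finset (Fin m)).card : ℝ) := by simp
  set g : Fin m → EuclideanSpace ℝ (Fin d) → EuclideanSpace ℝ (Fin d) :=
    fun k => gradient (Lk k) with hg
  -- gradient of ℓ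
  have hgrad : ∀ x, gradient ℓ x = (m:ℝ)⁻¹ • ∑ k, g k x := by
    intro x
    apply HasGradientAt.gradient
    rw [hasGradientAt_iff_hasFDerivAt]
    have h1 : HasFDerivAt (fun y => (m:ℝ)⁻¹ • ∑ k, Lk k y)
        ((m:ℝ)⁻¹ • ∑ k, InnerProductSpace.toDual ℝ _ (g k x)) x :=
      (HasFDerivAt.fun_sum (fun k _ => ((hdiff k) x).hasGradientAt.hasFDerivAt)).fun_const_smul _
    have h2 : ℓ = fun y => (m:ℝ)⁻¹ • ∑ k, Lk k y := by
      funext y; rw [hℓ, smul_eq_mul]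
    rw [h2]
    have h3 : InnerProductSpace.toDual ℝ _ ((m:ℝ)⁻¹ • ∑ k, g k x)
        = (m:ℝ)⁻¹ • ∑ k, InnerProductSpace.toDual ℝ _ (g k x) := by
      ext v
      simp [real_inner_smul_left, sum_inner]
    rw [h3]
    exact h1
  set G := gradient ℓ γbar with hG
  have hGe : G = (m:ℝ)⁻¹ • ∑ k, g k γbar := hgrad γbar
  have hℓd : Differentiable ℝ ℓ := by
    have h2 : ℓ = fun y => (m:ℝ)⁻¹ * ∑ k, Lk k y := by
      funext y; rw [hℓ]
    rw [h2]
    exact (Differentiable.fun_sum (fun k _ => hdiff k)).const_mul _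
  have hℓs : ∀ x y, ‖gradient ℓ x - gradient ℓ y‖ ≤ L * ‖x - y‖ := by
    intro x y
    rw [hgrad, hgrad, ← smul_sub, ← Finset.sum_sub_distrib, norm_smul, norm_inv,
      Real.norm_of_nonneg hm0.le]
    have : ‖∑ k, (g k x - g k y)‖ ≤ m * (L * ‖x - y‖) := by
      refine (norm_sum_le _ _).trans ?_
      refine (Finset.sum_le_sum (fun k _ => hsmooth k x y)).trans ?_
      simp
    rw [inv_mul_le_iff₀ hm0]
    exact this
  have hdesc := aux_descent ℓ L hℓd hℓs γbar
  set ε := (m:ℝ)⁻¹ * ∑ k, ‖θt k - γbar‖ ^ 2 with hε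
  set D := (m:ℝ)⁻¹ * ∑ k, ‖θ' k - γbar‖ ^ 2 with hD
  have hstep : ∀ k, α • (θt k - γbar) = -(g k (θt k) - g k (θ' k) + h) := by
    intro k
    have h1 := hfoc k
    have h2 : α • (θt k - γbar) = α • (θt k - θbar) - h := by
      rw [hγbar, smul_sub, smul_sub, smul_add, smul_smul, mul_inv_cancel₀ hα.ne', one_smul]
      abel
    rw [h2, eq_neg_of_add_eq_zero_right h1]
    abel
  -- (II)
  have hII : α ^ 2 * ε ≤ 3 * (L ^ 2 * ε + L ^ 2 * D + ‖G‖ ^ 2) := by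
    have hu : G - h = (m:ℝ)⁻¹ • ∑ k, (g k γbar - g k (θ' k)) := by
      rw [hGe, hh, Finset.sum_sub_distrib, smul_sub]
    have hvar := aux_var Finset.univ (fun k => g k γbar - g k (θ' k)) m hcard hm0 _ hu
    have hb1 : ∀ k, α ^ 2 * ‖θt k - γbar‖ ^ 2 ≤ 3 * (L ^ 2 * ‖θt k - γbar‖ ^ 2 +
        ‖(g k γbar - g k (θ' k)) - (G - h)‖ ^ 2 + ‖G‖ ^ 2) := by
      intro k
      have e1 : α ^ 2 * ‖θt k - γbar‖ ^ 2 = ‖(g k (θt k) - g k γbar) +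
          ((g k γbar - g k (θ' k)) - (G - h)) + G‖ ^ 2 := by
        have : (g k (θt k) - g k γbar) + ((g k γbar - g k (θ' k)) - (G - h)) + G
            = g k (θt k) - g k (θ' k) + h := by abel
        rw [this, ← norm_neg (g k (θt k) - g k (θ' k) + h), ← hstep k, norm_smul, mul_pow, Real.norm_of_nonneg hα.le]
      rw [e1]
      refine (aux_three _ _ _).trans ?_
      have e2 : ‖g k (θt k) - g k γbar‖ ^ 2 ≤ L ^ 2 * ‖θt k - γbar‖ ^ 2 := by
        rw [← mul_pow]
        exact pow_le_pow_left₀ (norm_nonneg _) (hsmooth k _ _) 2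
      linarith
    have hb2 : ∑ k, ‖g k γbar - g k (θ' k)‖ ^ 2 ≤ L ^ 2 * ∑ k, ‖θ' k - γbar‖ ^ 2 := by
      rw [Finset.mul_sum]
      refine Finset.sum_le_sum fun k _ => ?_
      rw [← mul_pow, norm_sub_rev (θ' k)]
      exact pow_le_pow_left₀ (norm_nonneg _) (hsmooth k _ _) 2
    have hb3 := Finset.sum_le_sum (fun k (_ : k ∈ Finset.univ) => hb1 k)
    rw [← Finset.mul_sum, ← Finset.mul_sum, Finset.sum_add_distrib, Finset.sum_add_distrib,
      ← Finset.mul_sum, Finset.sum_const, nsmul_eq_mul, ← hcard] at hb3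
    have e1 : ∑ k, ‖θt k - γbar‖ ^ 2 = m * ε := by rw [hε]; field_simp
    have e2 : ∑ k, ‖θ' k - γbar‖ ^ 2 = m * D := by rw [hD]; field_simp
    rw [e1] at hb3
    rw [e2] at hb2
    refine le_of_mul_le_mul_left ?_ hm0
    linarith
  have hε0 : 0 ≤ ε := by positivity
  have hD0 : 0 ≤ D := by positivity
  have hαc' : 20 * L * (m:ℝ) ≤ α * P := by
    rw [← mul_div_assoc, div_le_iff₀ hP0] at hαc
    exact hαc
  obtain ⟨hκ0, hfin⟩ := aux_arith m P α L ε D (‖G‖ ^ 2) z κ κ₀ (by exact_mod_cast hP1) hPm' hα hL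
    hαc' hε0 hD0 (by positivity) hz hκ hκ₀ hII
  set Ω := Finset.powersetCard P (Finset.univ : Finset (Fin m)) with hΩ
  have hΩ0 : (0:ℝ) < (Ω.card : ℝ) := by
    have : 0 < Ω.card := by
      rw [hΩ, Finset.card_powersetCard, Finset.card_univ, Fintype.card_fin]
      exact Nat.choose_pos hPm
    exact_mod_cast this
  have havg : ∀ f : Fin m → ℝ, (∑ S ∈ Ω, (P:ℝ)⁻¹ * ∑ k ∈ S, f k) / (Ω.card : ℝ)
      = (m:ℝ)⁻¹ * ∑ k, f k := by
    intro f
    rw [← aux_avg m P hP1 hPm f, ← Finset.mul_sum, mul_div_assoc]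
  have hSc : ∀ S ∈ Ω, (P:ℝ) = (S.card : ℝ) := by
    intro S hS
    rw [(Finset.mem_powersetCard.1 hS).2]
  have hγ : ∀ S ∈ Ω, (P:ℝ)⁻¹ • ∑ k ∈ S, θt k - γbar = (P:ℝ)⁻¹ • ∑ k ∈ S, (θt k - γbar) := by
    intro S hS
    rw [Finset.sum_sub_distrib, Finset.sum_const, ← Nat.cast_smul_eq_nsmul ℝ, ← hSc S hS, smul_sub,
      smul_smul, inv_mul_cancel₀ hP0.ne', one_smul]
  have hq : ∀ S ∈ Ω, ‖(P:ℝ)⁻¹ • ∑ k ∈ S, θt k - γbar‖ ^ 2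
      ≤ (P:ℝ)⁻¹ * ∑ k ∈ S, ‖θt k - γbar‖ ^ 2 := by
    intro S hS
    rw [hγ S hS]
    exact aux_jensen S _ _ (hSc S hS) hP0
  -- (I)
  have hI : (∑ S ∈ Ω, ℓ ((P : ℝ)⁻¹ • ∑ k ∈ S, θt k)) / (Ω.card : ℝ)
      ≤ ℓ γbar + (L ^ 2 / (2 * α) + L / 2) * ε - 1 / (2 * α) * ‖G‖ ^ 2 := by
    have h1 : ∀ S ∈ Ω, ℓ ((P : ℝ)⁻¹ • ∑ k ∈ S, θt k) ≤ ℓ γbar +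
        (P:ℝ)⁻¹ * ∑ k ∈ S, (inner ℝ G (θt k - γbar) + L / 2 * ‖θt k - γbar‖ ^ 2) := by
      intro S hS
      have e1 := hdesc ((P : ℝ)⁻¹ • ∑ k ∈ S, θt k)
      have e2 := hq S hS
      have e3 : inner ℝ G ((P:ℝ)⁻¹ • ∑ k ∈ S, θt k - γbar)
          = (P:ℝ)⁻¹ * ∑ k ∈ S, inner ℝ G (θt k - γbar) := by
        rw [hγ S hS, real_inner_smul_right, inner_sum]
      rw [← hG, e3] at e1
      rw [Finset.sum_add_distrib, ← Finset.mul_sum, mul_add]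
      have e4 := mul_le_mul_of_nonneg_left e2 (by positivity : 0 ≤ L / 2)
      linarith
    have h2 := Finset.sum_le_sum h1
    rw [Finset.sum_add_distrib, Finset.sum_const, nsmul_eq_mul] at h2
    have h3 := div_le_div_of_nonneg_right h2 hΩ0.le
    rw [add_div, havg, mul_div_cancel_left₀ _ hΩ0.ne', Finset.sum_add_distrib, ← Finset.mul_sum,
      ← inner_sum, mul_add] at h3
    set w := (m:ℝ)⁻¹ • ∑ k, g k (θt k) with hw
    have h4 : (m:ℝ)⁻¹ * inner ℝ G (∑ k, (θt k - γbar)) = -(α⁻¹ * inner ℝ G w) := by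
      have e1 : α • ∑ k, (θt k - γbar) = -(∑ k, g k (θt k)) := by
        rw [Finset.smul_sum, Finset.sum_congr rfl (fun k _ => hstep k), Finset.sum_neg_distrib,
          Finset.sum_add_distrib, Finset.sum_sub_distrib, Finset.sum_const,
          ← Nat.cast_smul_eq_nsmul ℝ, ← hcard, hh, smul_smul, mul_inv_cancel₀ hm0.ne', one_smul]
        abel
      have e2 : ∑ k, (θt k - γbar) = -(α⁻¹ • ∑ k, g k (θt k)) := by
        rw [← smul_neg, ← e1, smul_smul, inv_mul_cancel₀ hα.ne', one_smul]
      rw [e2, hw, inner_neg_right, real_inner_smul_right, real_inner_smul_right]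
      ring
    have h5 : ‖G - w‖ ^ 2 ≤ L ^ 2 * ε := by
      have e1 : G - w = (m:ℝ)⁻¹ • ∑ k, (g k γbar - g k (θt k)) := by
        rw [hGe, hw, Finset.sum_sub_distrib, smul_sub]
      rw [e1]
      refine (aux_jensen Finset.univ _ _ hcard hm0).trans ?_
      rw [hε, mul_left_comm]
      refine mul_le_mul_of_nonneg_left ?_ (by positivity)
      rw [Finset.mul_sum]
      refine Finset.sum_le_sum fun k _ => ?_
      rw [← mul_pow, norm_sub_rev (θt k)]
      exact pow_le_pow_left₀ (norm_nonneg _) (hsmooth k _ _) 2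
    have h6 : -(α⁻¹ * inner ℝ G w) ≤ 1 / (2 * α) * (L ^ 2 * ε) - 1 / (2 * α) * ‖G‖ ^ 2 := by
      rw [norm_sub_sq_real] at h5
      have e1 : -(2 * inner ℝ G w) ≤ L ^ 2 * ε - ‖G‖ ^ 2 := by
        have := sq_nonneg ‖w‖
        linarith
      have e2 := mul_le_mul_of_nonneg_left e1 (by positivity : 0 ≤ 1 / (2 * α))
      have e3 : 1 / (2 * α) * -(2 * inner ℝ G w) = -(α⁻¹ * inner ℝ G w) := by
        field_simp
      linarith
    have h7 : (m:ℝ)⁻¹ * (L / 2 * ∑ k, ‖θt k - γbar‖ ^ 2) = L / 2 * ε := by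
      rw [hε]; ring
    rw [h4, h7] at h3
    have h8 : L ^ 2 / (2 * α) * ε = 1 / (2 * α) * (L ^ 2 * ε) := by ring
    linarith
  -- (III)
  have hIII : (∑ S ∈ Ω, (m : ℝ)⁻¹ * ∑ k, ‖(if k ∈ S then θt k else θ' k) -
        (P : ℝ)⁻¹ • ∑ j ∈ S, θt j‖ ^ 2) / (Ω.card : ℝ)
      ≤ (1 - P / (2 * m)) * D + (P / m + (2 * m - P) / P) * ε := by
    set c : ℝ := P / (2 * (m - P)) with hc
    set b : ℝ := (m:ℝ)⁻¹ * (1 + c) * P with hb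
    have h1 : ∀ S ∈ Ω, (m : ℝ)⁻¹ * ∑ k, ‖(if k ∈ S then θt k else θ' k) -
        (P : ℝ)⁻¹ • ∑ j ∈ S, θt j‖ ^ 2 ≤ (1 + c) * D + (P:ℝ)⁻¹ * ∑ k ∈ S,
          ((P / m + (2 * m - P) / P) * ‖θt k - γbar‖ ^ 2 - b * ‖θ' k - γbar‖ ^ 2) := by
      intro S hS
      set γ := (P : ℝ)⁻¹ • ∑ j ∈ S, θt j with hγS
      have hqS := hq S hS
      rw [← hγS] at hqS
      have hsplit : ∀ f : Fin m → ℝ, ∑ k, f k = ∑ k ∈ S, f k + ∑ k ∈ Sᶜ, f k :=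
        fun f => (Finset.sum_add_sum_compl S f).symm
      rw [hsplit]
      have e1 : ∑ k ∈ S, ‖(if k ∈ S then θt k else θ' k) - γ‖ ^ 2
          ≤ ∑ k ∈ S, ‖θt k - γbar‖ ^ 2 := by
        have := aux_var S (fun k => θt k - γbar) P (hSc S hS) hP0 _ (hγ S hS)
        rw [← hγS] at this
        refine le_trans (le_of_eq ?_) this
        refine Finset.sum_congr rfl fun k hk => ?_
        rw [if_pos hk, sub_sub_sub_cancel_right]
      have e2 : ∑ k ∈ Sᶜ, ‖(if k ∈ S then θt k else θ' k) - γ‖ ^ 2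
          ≤ ∑ k ∈ Sᶜ, ((1 + c) * ‖θ' k - γbar‖ ^ 2 + (2 * m - P) / P * ‖γ - γbar‖ ^ 2) := by
        refine Finset.sum_le_sum fun k hk => ?_
        have hkS : k ∉ S := Finset.mem_compl.1 hk
        have hlt : (P:ℝ) < m := by
          have : S.card < Fintype.card (Fin m) := Finset.card_lt_univ_of_notMem hkS
          rw [Fintype.card_fin, (Finset.mem_powersetCard.1 hS).2] at this
          exact_mod_cast this
        have hmP : (0:ℝ) < m - P := by linarith
        have hc0 : 0 < c := by rw [hc]; positivity
        have := aux_young (θ' k - γbar) (γ - γbar) c hc0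
        rw [sub_sub_sub_cancel_right] at this
        have hce : 1 + c⁻¹ = (2 * m - P) / P := by
          rw [hc]; field_simp; ring
        rw [if_neg hkS, ← hce]
        exact this
      have hcc : ((Sᶜ.card : ℕ) : ℝ) = m - P := by
        rw [Finset.card_compl, Fintype.card_fin, (Finset.mem_powersetCard.1 hS).2,
          Nat.cast_sub hPm]
      rw [Finset.sum_add_distrib, Finset.sum_const, nsmul_eq_mul, hcc, ← Finset.mul_sum] at e2
      have e3 : ∑ k ∈ Sᶜ, ‖θ' k - γbar‖ ^ 2 = m * D - ∑ k ∈ S, ‖θ' k - γbar‖ ^ 2 := by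
        have := hsplit (fun k => ‖θ' k - γbar‖ ^ 2)
        have e : ∑ k, ‖θ' k - γbar‖ ^ 2 = m * D := by rw [hD]; field_simp
        linarith
      rw [e3] at e2
      have h2mP : (0:ℝ) < 2 * m - P := by linarith
      have e4 : (m - P) * ((2 * m - P) / P * ‖γ - γbar‖ ^ 2)
          ≤ m * ((2 * m - P) / P * ((P:ℝ)⁻¹ * ∑ k ∈ S, ‖θt k - γbar‖ ^ 2)) := by
        refine mul_le_mul (by linarith) ?_ (by positivity) hm0.le
        exact mul_le_mul_of_nonneg_left hqS (by positivity)
      rw [Finset.sum_sub_distrib, ← Finset.mul_sum, ← Finset.mul_sum]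
      set X := ∑ k ∈ S, ‖θt k - γbar‖ ^ 2
      set Y := ∑ k ∈ S, ‖θ' k - γbar‖ ^ 2
      rw [inv_mul_le_iff₀ hm0]
      have e5 : m * ((1 + c) * D + (P:ℝ)⁻¹ * ((P / m + (2 * m - P) / P) * X - b * Y))
          = X + ((1 + c) * (m * D - Y) +
            m * ((2 * m - P) / P * ((P:ℝ)⁻¹ * X))) := by
        rw [hb]; field_simp; ring
      rw [e5]
      linarith
    have h2 := Finset.sum_le_sum h1
    rw [Finset.sum_add_distrib, Finset.sum_const, nsmul_eq_mul] at h2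
    have h3 := div_le_div_of_nonneg_right h2 hΩ0.le
    rw [add_div, havg, mul_div_cancel_left₀ _ hΩ0.ne', Finset.sum_sub_distrib,
      ← Finset.mul_sum Finset.univ (fun k => ‖θt k - γbar‖ ^ 2),
      ← Finset.mul_sum Finset.univ (fun k => ‖θ' k - γbar‖ ^ 2)] at h3
    have e1 : ∑ k, ‖θt k - γbar‖ ^ 2 = m * ε := by rw [hε]; field_simp
    have e2 : ∑ k, ‖θ' k - γbar‖ ^ 2 = m * D := by rw [hD]; field_simp
    rw [e1, e2] at h3
    have e3 : (m:ℝ)⁻¹ * ((P / m + (2 * m - P) / P) * (m * ε) - b * (m * D))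
        = (P / m + (2 * m - P) / P) * ε - b * D := by
      field_simp
    rw [e3] at h3
    have e4 : 1 + c - b ≤ 1 - P / (2 * m) := by
      rcases eq_or_lt_of_le hPm' with he | hlt
      · rw [hb, hc, he, sub_self, mul_zero, div_zero]
        field_simp
        norm_num
      · have hmP : (m:ℝ) - P ≠ 0 := by linarith
        apply le_of_eq
        rw [hb, hc]
        field_simp
        ring
    have e5 := mul_le_mul_of_nonneg_right e4 hD0
    linarith
  have hIV := mul_le_mul_of_nonneg_left hIII hκ0
  linarith
end

section
/- (Lemma: expected one-round server drift.) The expectation over the uniformly random P-element active set of the change in the active-device average equals minus the average gradient at the virtual updates scaled by 1/α: E_𝒫[ γ(𝒫) − γ̄ ] = (1/(α·m)) ∑_{k=1}^m ( −∇L_k(θ̃_k) ). -/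
open scoped RealInnerProductSpace

theorem drift_sum_aux {E : Type*} [AddCommGroup E] [Module ℝ E] (m P : ℕ) (hP1 : 1 ≤ P)
    (f : Fin m → E) :
    ∑ S ∈ Finset.powersetCard P (Finset.univ : Finset (Fin m)), ∑ k ∈ S, f k =
      ((m - 1).choose (P - 1) : ℝ) • ∑ k, f k := by
  rw [Finset.sum_comm' (t' := Finset.univ)
    (s' := fun k => (Finset.powersetCard P (Finset.univ : Finset (Fin m))).filter ({k} ⊆ ·))]
  · rw [Finset.smul_sum]
    refine Finset.sum_congr rfl fun k _ => ?_
    rw [Finset.sum_const, Finset.card_filter_powersetCard_subset _ _ _ (by simp) (by simpa using hP1)]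
    simp [Nat.cast_smul_eq_nsmul]
  · intro S k
    simp

/-- expected one-round server drift. -/
theorem expected_one_round_server_drift
    (d m P : ℕ) (hd : 1 ≤ d) (hm : 1 ≤ m) (hP1 : 1 ≤ P) (hPm : P ≤ m)
    (α : ℝ) (hα : 0 < α)
    (Lk : Fin m → EuclideanSpace ℝ (Fin d) → ℝ)
    (hdiff : ∀ k, Differentiable ℝ (Lk k))
    (θbar : EuclideanSpace ℝ (Fin d))
    (g : Fin m → EuclideanSpace ℝ (Fin d))
    (h : EuclideanSpace ℝ (Fin d)) (hh : h = (m : ℝ)⁻¹ • ∑ k, g k)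
    (γbar : EuclideanSpace ℝ (Fin d)) (hγbar : γbar = θbar + α⁻¹ • h)
    (θt : Fin m → EuclideanSpace ℝ (Fin d))
    (hfoc : ∀ k, gradient (Lk k) (θt k) - g k + α • (θt k - θbar) = 0) :
    (((Finset.powersetCard P (Finset.univ : Finset (Fin m))).card : ℝ)⁻¹) •
      ∑ S ∈ Finset.powersetCard P (Finset.univ : Finset (Fin m)),
        ((P : ℝ)⁻¹ • ∑ k ∈ S, θt k - γbar) =
    (α * m : ℝ)⁻¹ • ∑ k, (-(gradient (Lk k) (θt k))) := by
  have hα' : α ≠ 0 := hα.ne'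
  have hm' : (m : ℝ) ≠ 0 := by positivity
  have hP' : (P : ℝ) ≠ 0 := by positivity
  have hC : (m.choose P : ℝ) ≠ 0 := by
    exact_mod_cast (Nat.choose_pos hPm).ne'
  have hchoose : (m : ℝ) * ((m - 1).choose (P - 1) : ℝ) = (m.choose P : ℝ) * P := by
    obtain ⟨n, rfl⟩ := Nat.exists_eq_add_of_le' hm
    obtain ⟨p, rfl⟩ := Nat.exists_eq_add_of_le' hP1
    exact_mod_cast Nat.add_one_mul_choose_eq n p
  have hgrad : ∀ k, -(gradient (Lk k) (θt k)) = α • θt k - α • θbar - g k := by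
    intro k
    have := hfoc k
    rw [smul_sub] at this
    rw [neg_eq_iff_add_eq_zero, ← this]
    abel
  rw [Finset.sum_congr rfl (fun k _ => hgrad k), Finset.sum_sub_distrib, Finset.sum_sub_distrib,
    Finset.sum_sub_distrib, ← Finset.smul_sum, drift_sum_aux m P hP1, ← Finset.smul_sum, hγbar, hh]
  simp only [Finset.sum_const, Finset.card_powersetCard, Finset.card_univ, Fintype.card_fin,
    ← Nat.cast_smul_eq_nsmul ℝ]
  have hc : ((m - 1).choose (P - 1) : ℝ) = (m.choose P : ℝ) * P / m := by
    field_simp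
    linarith
  rw [hc]
  match_scalars <;> field_simp
end

section
/- (Lemma: bound on device dispersion, convex case.) With ε = (1/m) ∑_{k=1}^m ‖θ̃_k − γ̄‖² and C = (1/m) ∑_{k=1}^m ‖g_k − ∇L_k(θ*)‖², the inequality ( 1 − 4L²/α² )·ε ≤ (8/α²)·C + (8L/α²)·( ℓ(γ̄) − ℓ(θ*) ) holds. -/
open scoped RealInnerProductSpace

section helpers
variable {E : Type*} [NormedAddCommGroup E] [InnerProductSpace ℝ E] [CompleteSpace E]

theorem line_hasDerivAt {f : E → ℝ} (hf : Differentiable ℝ f) (x v : E) (t : ℝ) :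
    HasDerivAt (fun s : ℝ => f (x + s • v)) (inner ℝ (gradient f (x + t • v)) v) t := by
  have h1 : HasDerivAt (fun s : ℝ => x + s • v) v t := by
    simpa using ((hasDerivAt_id t).smul_const v).const_add x
  have h2 := (hf (x + t • v)).hasFDerivAt.comp_hasDerivAt t h1
  rw [inner_gradient_left]
  exact h2

theorem convex_grad_le {f : E → ℝ} (hf : Differentiable ℝ f) (hc : ConvexOn ℝ Set.univ f)
    (x y : E) : f x + inner ℝ (gradient f x) (y - x) ≤ f y := by
  have hc' : ConvexOn ℝ Set.univ (fun s : ℝ => f (x + s • (y - x))) := by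
    have := hc.comp_affineMap (AffineMap.lineMap x y : ℝ →ᵃ[ℝ] E)
    rw [Set.preimage_univ] at this
    have e : (fun s : ℝ => f (x + s • (y - x))) = f ∘ (AffineMap.lineMap x y : ℝ →ᵃ[ℝ] E) := by
      funext s
      simp [AffineMap.lineMap_apply, add_comm]
    rw [e]
    exact this
  have hd := line_hasDerivAt hf x (y - x) 0
  have := hc'.le_slope_of_hasDerivAt (Set.mem_univ 0) (Set.mem_univ 1) one_pos hd
  simp [slope_def_field, -inner_gradient_left] at this
  linarith

theorem descent {f : E → ℝ} (hf : Differentiable ℝ f) {L : ℝ}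
    (hs : ∀ x y, ‖gradient f x - gradient f y‖ ≤ L * ‖x - y‖) (x v : E) :
    f (x + v) ≤ f x + inner ℝ (gradient f x) v + L / 2 * ‖v‖ ^ 2 := by
  have hd : ∀ t : ℝ, HasDerivAt
      (fun s : ℝ => f (x + s • v) - (s * inner ℝ (gradient f x) v + s ^ 2 * (L / 2 * ‖v‖ ^ 2)))
      (inner ℝ (gradient f (x + t • v)) v -
        (1 * inner ℝ (gradient f x) v + (2 * t) * (L / 2 * ‖v‖ ^ 2))) t := by
    intro t
    refine (line_hasDerivAt hf x v t).sub (((hasDerivAt_id t).mul_const _).add ?_)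
    simpa using (hasDerivAt_pow 2 t).mul_const (L / 2 * ‖v‖ ^ 2)
  have hanti := antitoneOn_of_deriv_nonpos (convex_Icc (0 : ℝ) 1)
    (fun t _ => (hd t).continuousAt.continuousWithinAt)
    (fun t _ => (hd t).differentiableAt.differentiableWithinAt)
    (fun t ht => by
      rw [interior_Icc] at ht
      rw [(hd t).deriv]
      have h1 := real_inner_le_norm (gradient f (x + t • v) - gradient f x) v
      have h2 := hs (x + t • v) x
      rw [add_sub_cancel_left, norm_smul, Real.norm_of_nonneg ht.1.le] at h2
      have h3 := mul_le_mul_of_nonneg_right h2 (norm_nonneg v)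
      rw [inner_sub_left] at h1
      nlinarith)
  have := hanti (Set.left_mem_Icc.2 zero_le_one) (Set.right_mem_Icc.2 zero_le_one) zero_le_one
  simp [-inner_gradient_left] at this
  linarith

theorem grad_sq_le {f : E → ℝ} (hf : Differentiable ℝ f) (hc : ConvexOn ℝ Set.univ f)
    {L : ℝ} (hL : 0 < L)
    (hs : ∀ x y, ‖gradient f x - gradient f y‖ ≤ L * ‖x - y‖) (x y : E) :
    ‖gradient f x - gradient f y‖ ^ 2 ≤
      2 * L * (f y - f x - inner ℝ (gradient f x) (y - x)) := by
  set w := gradient f x - gradient f y with hw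
  have h1 := descent hf hs y (L⁻¹ • w)
  have h2 := convex_grad_le hf hc x (y + L⁻¹ • w)
  have e : y + L⁻¹ • w - x = (y - x) + L⁻¹ • w := by abel
  rw [e, inner_add_right, inner_smul_right] at h2
  rw [inner_smul_right, norm_smul, Real.norm_of_nonneg (inv_pos.2 hL).le] at h1
  have h3 : inner ℝ (gradient f x) w - inner ℝ (gradient f y) w = ‖w‖ ^ 2 := by
    rw [← inner_sub_left, ← hw, real_inner_self_eq_norm_sq]
  have h4 : L / 2 * (L⁻¹ * ‖w‖) ^ 2 = L⁻¹ * ‖w‖ ^ 2 / 2 := by field_simp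
  have h5 : L⁻¹ * ‖w‖ ^ 2 / 2 ≤ f y - f x - inner ℝ (gradient f x) (y - x) := by
    have : L⁻¹ * inner ℝ (gradient f x) w - L⁻¹ * inner ℝ (gradient f y) w = L⁻¹ * ‖w‖ ^ 2 := by
      rw [← h3]; ring
    linarith
  calc ‖w‖ ^ 2 = 2 * L * (L⁻¹ * ‖w‖ ^ 2 / 2) := by field_simp
    _ ≤ _ := by gcongr

theorem four_sq (a b c e : E) :
    ‖a + b + c - e‖ ^ 2 ≤ 4 * (‖a‖ ^ 2 + ‖b‖ ^ 2 + ‖c‖ ^ 2 + ‖e‖ ^ 2) := by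
  have h : ‖a + b + c - e‖ ≤ ‖a‖ + ‖b‖ + ‖c‖ + ‖e‖ :=
    (norm_sub_le _ _).trans (by gcongr; exact norm_add₃_le)
  have := pow_le_pow_left₀ (norm_nonneg _) h 2
  nlinarith [sq_nonneg (‖a‖ - ‖b‖), sq_nonneg (‖a‖ - ‖c‖), sq_nonneg (‖a‖ - ‖e‖),
    sq_nonneg (‖b‖ - ‖c‖), sq_nonneg (‖b‖ - ‖e‖), sq_nonneg (‖c‖ - ‖e‖)]

end helpers

/-- bound on device dispersion, convex case. -/
theorem device_dispersion_convex
    (d m : ℕ) (hd : 1 ≤ d) (hm : 1 ≤ m)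
    (α L : ℝ) (hα : 0 < α) (hL : 0 < L)
    (Lk : Fin m → EuclideanSpace ℝ (Fin d) → ℝ)
    (hdiff : ∀ k, Differentiable ℝ (Lk k))
    (hconv : ∀ k, ConvexOn ℝ Set.univ (Lk k))
    (hsmooth : ∀ k x y, ‖gradient (Lk k) x - gradient (Lk k) y‖ ≤ L * ‖x - y‖)
    (ℓ : EuclideanSpace ℝ (Fin d) → ℝ)
    (hℓ : ∀ θ, ℓ θ = (m : ℝ)⁻¹ * ∑ k, Lk k θ)
    (θstar : EuclideanSpace ℝ (Fin d)) (hmin : ∀ θ, ℓ θstar ≤ ℓ θ)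
    (θbar : EuclideanSpace ℝ (Fin d))
    (g : Fin m → EuclideanSpace ℝ (Fin d))
    (h : EuclideanSpace ℝ (Fin d)) (hh : h = (m : ℝ)⁻¹ • ∑ k, g k)
    (γbar : EuclideanSpace ℝ (Fin d)) (hγbar : γbar = θbar + α⁻¹ • h)
    (θt : Fin m → EuclideanSpace ℝ (Fin d))
    (hfoc : ∀ k, gradient (Lk k) (θt k) - g k + α • (θt k - θbar) = 0) :
    (1 - 4 * L ^ 2 / α ^ 2) * ((m : ℝ)⁻¹ * ∑ k, ‖θt k - γbar‖ ^ 2) ≤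
      8 / α ^ 2 * ((m : ℝ)⁻¹ * ∑ k, ‖g k - gradient (Lk k) θstar‖ ^ 2) +
      8 * L / α ^ 2 * (ℓ γbar - ℓ θstar) := by
  have hm0 : (0 : ℝ) < m := by exact_mod_cast hm
  have hsum0 : ∑ k, gradient (Lk k) θstar = 0 := by
    apply ext_inner_right ℝ
    intro v
    rw [inner_zero_left, sum_inner]
    have hd : HasDerivAt (fun s : ℝ => ∑ k, Lk k (θstar + s • v))
        (∑ k, inner ℝ (gradient (Lk k) θstar) v) 0 := by
      have := HasDerivAt.fun_sum (u := Finset.univ)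
        (fun k _ => line_hasDerivAt (hdiff k) θstar v 0)
      simpa using this
    refine IsLocalMin.hasDerivAt_eq_zero (Filter.Eventually.of_forall fun s => ?_) hd
    have := hmin (θstar + s • v)
    rw [hℓ, hℓ] at this
    simpa using le_of_mul_le_mul_left this (inv_pos.2 hm0)
  have hB : ∑ k, ‖gradient (Lk k) θstar - gradient (Lk k) γbar‖ ^ 2 ≤
      2 * L * (m * (ℓ γbar - ℓ θstar)) := by
    calc _ ≤ ∑ k, 2 * L * (Lk k γbar - Lk k θstar -
            inner ℝ (gradient (Lk k) θstar) (γbar - θstar)) :=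
          Finset.sum_le_sum fun k _ => grad_sq_le (hdiff k) (hconv k) hL (hsmooth k) _ _
      _ = _ := by
          rw [← Finset.mul_sum, Finset.sum_sub_distrib, Finset.sum_sub_distrib, ← sum_inner,
            hsum0, inner_zero_left, hℓ, hℓ]
          field_simp
          ring
  have hH : m * ‖h‖ ^ 2 ≤ ∑ k, ‖g k - gradient (Lk k) θstar‖ ^ 2 := by
    have e : (m : ℝ) • h = ∑ k, (g k - gradient (Lk k) θstar) := by
      rw [Finset.sum_sub_distrib, hsum0, sub_zero, hh, smul_smul, mul_inv_cancel₀ hm0.ne',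
        one_smul]
    have h1 : m * ‖h‖ ≤ ∑ k, ‖g k - gradient (Lk k) θstar‖ := by
      have := norm_sum_le Finset.univ (fun k => g k - gradient (Lk k) θstar)
      rw [← e, norm_smul, Real.norm_of_nonneg hm0.le] at this
      exact this
    have h2 := pow_le_pow_left₀ (by positivity) h1 2
    have h3 := sq_sum_le_card_mul_sum_sq (s := Finset.univ)
      (f := fun k => ‖g k - gradient (Lk k) θstar‖)
    rw [Finset.card_univ, Fintype.card_fin] at h3
    refine le_of_mul_le_mul_left ?_ hm0
    calc (m : ℝ) * (m * ‖h‖ ^ 2) = (m * ‖h‖) ^ 2 := by ring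
      _ ≤ _ := h2.trans h3
  have hk : ∀ k, α ^ 2 * ‖θt k - γbar‖ ^ 2 ≤ 4 * (‖g k - gradient (Lk k) θstar‖ ^ 2 +
      ‖gradient (Lk k) θstar - gradient (Lk k) γbar‖ ^ 2 + L ^ 2 * ‖θt k - γbar‖ ^ 2
      + ‖h‖ ^ 2) := by
    intro k
    have e : α • (θt k - γbar) = (g k - gradient (Lk k) θstar) +
        (gradient (Lk k) θstar - gradient (Lk k) γbar) +
        (gradient (Lk k) γbar - gradient (Lk k) (θt k)) - h := by
      have h1 : α • (θt k - θbar) = g k - gradient (Lk k) (θt k) := by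
        have := hfoc k
        rw [← sub_eq_zero, ← this]; abel
      rw [hγbar, ← sub_sub, smul_sub, h1, smul_smul, mul_inv_cancel₀ hα.ne', one_smul]
      abel
    have h1 := four_sq (g k - gradient (Lk k) θstar)
        (gradient (Lk k) θstar - gradient (Lk k) γbar)
        (gradient (Lk k) γbar - gradient (Lk k) (θt k)) h
    rw [← e, norm_smul, Real.norm_of_nonneg hα.le, mul_pow] at h1
    have h2 := pow_le_pow_left₀ (norm_nonneg _) (hsmooth k γbar (θt k)) 2
    rw [norm_sub_rev γbar, mul_pow] at h2
    linarith
  have hS := Finset.sum_le_sum fun k (_ : k ∈ Finset.univ) => hk k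
  simp only [← Finset.mul_sum, Finset.sum_add_distrib, Finset.sum_const, Finset.card_univ,
    Fintype.card_fin, nsmul_eq_mul] at hS
  generalize (∑ k, ‖θt k - γbar‖ ^ 2) = ε at *
  generalize (∑ k, ‖g k - gradient (Lk k) θstar‖ ^ 2) = C at *
  have hfin : (α ^ 2 - 4 * L ^ 2) * ε ≤ 8 * C + 8 * L * (m * (ℓ γbar - ℓ θstar)) := by
    linarith
  have hpos : (0 : ℝ) < (α ^ 2)⁻¹ * (m : ℝ)⁻¹ := by positivity
  have := mul_le_mul_of_nonneg_left hfin hpos.le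
  calc _ = (α ^ 2)⁻¹ * (m : ℝ)⁻¹ * ((α ^ 2 - 4 * L ^ 2) * ε) := by field_simp
    _ ≤ _ := this
    _ = _ := by field_simp
end

section
/- (Lemma: bound on device dispersion, nonconvex case.) With ε = (1/m) ∑_{k=1}^m ‖θ̃_k − γ̄‖² and D = (1/m) ∑_{k=1}^m ‖θ'_k − γ̄‖², the inequality ( 1 − 4L²/α² )·ε ≤ (8L²/α²)·D + (4/α²)·‖∇ℓ(γ̄)‖² holds. -/
open scoped RealInnerProductSpace

/-- bound on device dispersion, nonconvex case. -/
theorem device_dispersion_nonconvex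
    (d m : ℕ) (hd : 1 ≤ d) (hm : 1 ≤ m)
    (α L : ℝ) (hα : 0 < α) (hL : 0 < L)
    (Lk : Fin m → EuclideanSpace ℝ (Fin d) → ℝ)
    (hdiff : ∀ k, Differentiable ℝ (Lk k))
    (hsmooth : ∀ k x y, ‖gradient (Lk k) x - gradient (Lk k) y‖ ≤ L * ‖x - y‖)
    (ℓ : EuclideanSpace ℝ (Fin d) → ℝ)
    (hℓ : ∀ θ, ℓ θ = (m : ℝ)⁻¹ * ∑ k, Lk k θ)
    (θbar : EuclideanSpace ℝ (Fin d))
    (θ' : Fin m → EuclideanSpace ℝ (Fin d))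
    (h : EuclideanSpace ℝ (Fin d)) (hh : h = (m : ℝ)⁻¹ • ∑ k, gradient (Lk k) (θ' k))
    (γbar : EuclideanSpace ℝ (Fin d)) (hγbar : γbar = θbar + α⁻¹ • h)
    (θt : Fin m → EuclideanSpace ℝ (Fin d))
    (hfoc : ∀ k, gradient (Lk k) (θt k) - gradient (Lk k) (θ' k) + α • (θt k - θbar) = 0) :
    (1 - 4 * L ^ 2 / α ^ 2) * ((m : ℝ)⁻¹ * ∑ k, ‖θt k - γbar‖ ^ 2) ≤
      8 * L ^ 2 / α ^ 2 * ((m : ℝ)⁻¹ * ∑ k, ‖θ' k - γbar‖ ^ 2) +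
      4 / α ^ 2 * ‖gradient ℓ γbar‖ ^ 2 := by
  have hm0 : (0 : ℝ) < m := by exact_mod_cast hm
  have hα2 : (0 : ℝ) < α ^ 2 := by positivity
  -- gradient of the average
  have hgrad : gradient ℓ γbar = (m : ℝ)⁻¹ • ∑ k, gradient (Lk k) γbar := by
    apply HasGradientAt.gradient
    rw [hasGradientAt_iff_hasFDerivAt]
    have h1 : ∀ k ∈ Finset.univ, HasFDerivAt (Lk k)
        ((InnerProductSpace.toDual ℝ (EuclideanSpace ℝ (Fin d))) (gradient (Lk k) γbar)) γbar :=
      fun k _ => ((hdiff k) γbar).hasGradientAt.hasFDerivAt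
    have h2 := (HasFDerivAt.fun_sum h1).const_mul ((m : ℝ)⁻¹)
    have h3 : ℓ = fun θ => (m : ℝ)⁻¹ * ∑ k, Lk k θ := funext hℓ
    rw [h3]
    have h4 : (InnerProductSpace.toDual ℝ (EuclideanSpace ℝ (Fin d)))
        ((m : ℝ)⁻¹ • ∑ k, gradient (Lk k) γbar) = (m : ℝ)⁻¹ • ∑ k,
        (InnerProductSpace.toDual ℝ (EuclideanSpace ℝ (Fin d))) (gradient (Lk k) γbar) := by
      rw [map_smulₛₗ, map_sum]
      rfl
    rw [h4]
    exact h2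
  set G := gradient ℓ γbar with hG
  set S := ∑ k, ‖θt k - γbar‖ ^ 2 with hS
  set T := ∑ k, ‖θ' k - γbar‖ ^ 2 with hT
  have sqs : ∀ k x y, ‖gradient (Lk k) x - gradient (Lk k) y‖ ^ 2 ≤ L ^ 2 * ‖x - y‖ ^ 2 := by
    intro k x y
    rw [← mul_pow]
    exact pow_le_pow_left₀ (norm_nonneg _) (hsmooth k x y) 2
  -- Jensen
  have hJ : ‖G - h‖ ^ 2 ≤ L ^ 2 * ((m : ℝ)⁻¹ * T) := by
    have e : G - h = (m : ℝ)⁻¹ • ∑ k, (gradient (Lk k) γbar - gradient (Lk k) (θ' k)) := by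
      rw [hgrad, hh, Finset.sum_sub_distrib, smul_sub]
    have h1 : ‖∑ k, (gradient (Lk k) γbar - gradient (Lk k) (θ' k))‖ ^ 2 ≤ m * (L ^ 2 * T) := by
      calc _ ≤ (∑ k, ‖gradient (Lk k) γbar - gradient (Lk k) (θ' k)‖) ^ 2 :=
            pow_le_pow_left₀ (norm_nonneg _) (norm_sum_le _ _) 2
        _ ≤ m * ∑ k, ‖gradient (Lk k) γbar - gradient (Lk k) (θ' k)‖ ^ 2 := by
            simpa using sq_sum_le_card_mul_sum_sq (s := Finset.univ)
              (f := fun k => ‖gradient (Lk k) γbar - gradient (Lk k) (θ' k)‖)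
        _ ≤ m * (L ^ 2 * T) := by
            apply mul_le_mul_of_nonneg_left _ hm0.le
            rw [hT, Finset.mul_sum]
            apply Finset.sum_le_sum
            intro k _
            rw [norm_sub_rev (θ' k)]
            exact sqs k _ _
    rw [e, norm_smul, mul_pow, Real.norm_of_nonneg (by positivity)]
    calc _ ≤ ((m : ℝ)⁻¹) ^ 2 * (m * (L ^ 2 * T)) := by gcongr
      _ = L ^ 2 * ((m : ℝ)⁻¹ * T) := by field_simp
  have hk : ∀ k, α ^ 2 * ‖θt k - γbar‖ ^ 2 ≤ 4 * (L ^ 2 * ‖θ' k - γbar‖ ^ 2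
      + L ^ 2 * ‖θt k - γbar‖ ^ 2 + L ^ 2 * ((m : ℝ)⁻¹ * T) + ‖G‖ ^ 2) := by
    intro k
    have e : α • (θt k - γbar) = (gradient (Lk k) (θ' k) - gradient (Lk k) γbar)
        - (gradient (Lk k) (θt k) - gradient (Lk k) γbar) + (G - h) - G := by
      have h1 : α • (θt k - γbar) = α • (θt k - θbar) - h := by
        rw [hγbar, ← sub_sub, smul_sub α (θt k - θbar), smul_inv_smul₀ hα.ne']
      have h2 : α • (θt k - θbar) = gradient (Lk k) (θ' k) - gradient (Lk k) (θt k) := by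
        rw [eq_neg_of_add_eq_zero_right (hfoc k)]; abel
      rw [h1, h2]; abel
    have e2 : α ^ 2 * ‖θt k - γbar‖ ^ 2 = ‖α • (θt k - γbar)‖ ^ 2 := by
      rw [norm_smul, mul_pow, Real.norm_of_nonneg hα.le]
    rw [e2, e]
    have a1 := sqs k (θ' k) γbar
    have a2 := sqs k (θt k) γbar
    generalize gradient (Lk k) (θ' k) - gradient (Lk k) γbar = a at *
    generalize gradient (Lk k) (θt k) - gradient (Lk k) γbar = b at *
    have t : ‖a - b + (G - h) - G‖ ≤ ‖a‖ + ‖b‖ + ‖G - h‖ + ‖G‖ := by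
      have t1 := norm_sub_le (a - b + (G - h)) G
      have t2 := norm_add_le (a - b) (G - h)
      have t3 := norm_sub_le a b
      linarith
    have t' := pow_le_pow_left₀ (norm_nonneg _) t 2
    nlinarith [sq_nonneg (‖a‖ - ‖b‖), sq_nonneg (‖a‖ - ‖G - h‖), sq_nonneg (‖a‖ - ‖G‖),
      sq_nonneg (‖b‖ - ‖G - h‖), sq_nonneg (‖b‖ - ‖G‖), sq_nonneg (‖G - h‖ - ‖G‖)]
  have hsum := Finset.sum_le_sum (s := Finset.univ) fun k _ => hk k
  simp only [← Finset.mul_sum, Finset.sum_add_distrib, Finset.sum_const, Finset.card_univ,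
    Fintype.card_fin, nsmul_eq_mul] at hsum
  rw [← hS, ← hT] at hsum
  have hfin : (α ^ 2 - 4 * L ^ 2) * S ≤ 8 * L ^ 2 * T + 4 * m * ‖G‖ ^ 2 := by
    have : (m : ℝ) * (L ^ 2 * ((m : ℝ)⁻¹ * T)) = L ^ 2 * T := by field_simp
    linarith
  have l : (1 - 4 * L ^ 2 / α ^ 2) * ((m : ℝ)⁻¹ * S)
      = ((α ^ 2 - 4 * L ^ 2) * S) / (α ^ 2 * m) := by field_simp
  have r : 8 * L ^ 2 / α ^ 2 * ((m : ℝ)⁻¹ * T) + 4 / α ^ 2 * ‖G‖ ^ 2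
      = (8 * L ^ 2 * T + 4 * m * ‖G‖ ^ 2) / (α ^ 2 * m) := by field_simp
  rw [l, r]
  gcongr
end

section
/- (Lemma: one-round evolution of device-model dispersion, nonconvex case.) With D = (1/m) ∑_{k=1}^m ‖θ'_k − γ̄‖², ε = (1/m) ∑_{k=1}^m ‖θ̃_k − γ̄‖², and D⁺(𝒫) = (1/m) ∑_{k=1}^m ‖θ_k(𝒫) − γ(𝒫)‖², the inequality E_𝒫[ D⁺(𝒫) ] ≤ 2·((m − P)/(2m − P))·D + 2·(P/(2m − P))·ε + 2·(m/P)·E_𝒫[ ‖γ(𝒫) − γ̄‖² ] holds. -/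
open scoped RealInnerProductSpace

lemma aux_young_s13 {E : Type*} [NormedAddCommGroup E] (x g c : E) (m P : ℝ)
    (hP : 0 < P) (hPm : P ≤ m) :
    ‖x - g‖ ^ 2 ≤ 2 * m / (2 * m - P) * ‖x - c‖ ^ 2 + 2 * m / P * ‖g - c‖ ^ 2 := by
  have hQ : 0 < 2 * m - P := by linarith
  have h1 : ‖x - g‖ ≤ ‖x - c‖ + ‖g - c‖ := by
    have h2 := norm_sub_le (x - c) (g - c)
    rwa [sub_sub_sub_cancel_right] at h2
  have h3 : ‖x - g‖ ^ 2 ≤ (‖x - c‖ + ‖g - c‖) ^ 2 := by gcongr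
  refine h3.trans ?_
  generalize ‖x - c‖ = u
  generalize ‖g - c‖ = v
  have key : 2 * m / (2 * m - P) * u ^ 2 + 2 * m / P * v ^ 2 - (u + v) ^ 2
      = (P * u - (2 * m - P) * v) ^ 2 / (P * (2 * m - P)) := by
    have := hQ.ne'
    field_simp
    ring
  have : 0 ≤ (P * u - (2 * m - P) * v) ^ 2 / (P * (2 * m - P)) := by positivity
  linarith

lemma aux_count (m P : ℕ) (hm : 1 ≤ m) (hPm : P ≤ m) (k : Fin m) (a b : ℝ) :
    (m : ℝ) * ∑ S ∈ Finset.powersetCard P (Finset.univ : Finset (Fin m)),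
      (if k ∈ S then a else b)
      = ((Finset.powersetCard P (Finset.univ : Finset (Fin m))).card : ℝ)
        * (P * a + (m - P) * b) := by
  have h1 : (Finset.powersetCard P (Finset.univ : Finset (Fin m))).filter (fun S => ¬ k ∈ S)
      = Finset.powersetCard P (Finset.univ.erase k) := by
    ext S
    simp only [Finset.mem_filter, Finset.mem_powersetCard, Finset.subset_erase]
    tauto
  have h2 : (((Finset.powersetCard P (Finset.univ : Finset (Fin m))).filter
      (fun S => ¬ k ∈ S)).card : ℝ) * m = (m.choose P : ℝ) * (m - P) := by
    rw [h1, Finset.card_powersetCard, Finset.card_erase_of_mem (Finset.mem_univ k),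
      Finset.card_univ, Fintype.card_fin]
    have h3 := Nat.choose_mul_succ_eq (m - 1) P
    rw [Nat.sub_add_cancel hm] at h3
    rw [← Nat.cast_sub hPm]
    exact_mod_cast h3
  have h4 := Finset.card_filter_add_card_filter_not
    (s := Finset.powersetCard P (Finset.univ : Finset (Fin m))) (fun S => k ∈ S)
  have h5 : (Finset.powersetCard P (Finset.univ : Finset (Fin m))).card = m.choose P := by
    simp
  rw [h5] at h4 ⊢
  have h6 : (((Finset.powersetCard P (Finset.univ : Finset (Fin m))).filter
      (fun S => k ∈ S)).card : ℝ) + (((Finset.powersetCard P (Finset.univ : Finset (Fin m))).filter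
      (fun S => ¬ k ∈ S)).card : ℝ) = (m.choose P : ℝ) := by exact_mod_cast h4
  rw [Finset.sum_ite, Finset.sum_const, Finset.sum_const, nsmul_eq_mul, nsmul_eq_mul]
  linear_combination (m * a) * h6 + (b - a) * h2

/-- one-round evolution of device-model dispersion, nonconvex case. -/
theorem device_dispersion_evolution_nonconvex
    (d m P : ℕ) (hd : 1 ≤ d) (hm : 1 ≤ m) (hP1 : 1 ≤ P) (hPm : P ≤ m)
    (α : ℝ) (hα : 0 < α)
    (Lk : Fin m → EuclideanSpace ℝ (Fin d) → ℝ)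
    (hdiff : ∀ k, Differentiable ℝ (Lk k))
    (θbar : EuclideanSpace ℝ (Fin d))
    (θ' : Fin m → EuclideanSpace ℝ (Fin d))
    (h : EuclideanSpace ℝ (Fin d)) (hh : h = (m : ℝ)⁻¹ • ∑ k, gradient (Lk k) (θ' k))
    (γbar : EuclideanSpace ℝ (Fin d)) (hγbar : γbar = θbar + α⁻¹ • h)
    (θt : Fin m → EuclideanSpace ℝ (Fin d))
    (hfoc : ∀ k, gradient (Lk k) (θt k) - gradient (Lk k) (θ' k) + α • (θt k - θbar) = 0) :
    (∑ S ∈ Finset.powersetCard P (Finset.univ : Finset (Fin m)),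
        (m : ℝ)⁻¹ * ∑ k, ‖(if k ∈ S then θt k else θ' k) - (P : ℝ)⁻¹ • ∑ j ∈ S, θt j‖ ^ 2) /
      ((Finset.powersetCard P (Finset.univ : Finset (Fin m))).card : ℝ) ≤
    2 * (((m : ℝ) - P) / (2 * (m : ℝ) - P)) * ((m : ℝ)⁻¹ * ∑ k, ‖θ' k - γbar‖ ^ 2) +
      2 * ((P : ℝ) / (2 * (m : ℝ) - P)) * ((m : ℝ)⁻¹ * ∑ k, ‖θt k - γbar‖ ^ 2) +
      2 * ((m : ℝ) / P) *
        ((∑ S ∈ Finset.powersetCard P (Finset.univ : Finset (Fin m)),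
            ‖(P : ℝ)⁻¹ • ∑ k ∈ S, θt k - γbar‖ ^ 2) /
          ((Finset.powersetCard P (Finset.univ : Finset (Fin m))).card : ℝ)) := by
  have hP0 : (0 : ℝ) < P := by exact_mod_cast hP1
  have hPm' : (P : ℝ) ≤ m := by exact_mod_cast hPm
  have hm0 : (0 : ℝ) < m := by linarith
  have hQ : (0 : ℝ) < 2 * m - P := by linarith
  clear hfoc hγbar hh hdiff
  have hN : (0 : ℝ) < ((Finset.powersetCard P (Finset.univ : Finset (Fin m))).card : ℝ) := by
    have : 0 < m.choose P := Nat.choose_pos hPm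
    simpa using this
  have hcount : ∑ S ∈ Finset.powersetCard P (Finset.univ : Finset (Fin m)), ∑ k,
      ‖(if k ∈ S then θt k else θ' k) - γbar‖ ^ 2
      = ((Finset.powersetCard P (Finset.univ : Finset (Fin m))).card : ℝ) / m *
        (P * ∑ k, ‖θt k - γbar‖ ^ 2 + (m - P) * ∑ k, ‖θ' k - γbar‖ ^ 2) := by
    rw [Finset.sum_comm, Finset.mul_sum, Finset.mul_sum, ← Finset.sum_add_distrib,
      Finset.mul_sum]
    refine Finset.sum_congr rfl fun k _ => ?_
    have h1 := aux_count m P hm hPm k (‖θt k - γbar‖ ^ 2) (‖θ' k - γbar‖ ^ 2)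
    have h2 : ∀ S : Finset (Fin m), ‖(if k ∈ S then θt k else θ' k) - γbar‖ ^ 2
        = if k ∈ S then ‖θt k - γbar‖ ^ 2 else ‖θ' k - γbar‖ ^ 2 := by
      intro S
      split_ifs <;> rfl
    simp only [h2]
    rw [div_mul_eq_mul_div, ← h1]
    field_simp
  have hS : ∀ S ∈ Finset.powersetCard P (Finset.univ : Finset (Fin m)),
      (m : ℝ)⁻¹ * ∑ k, ‖(if k ∈ S then θt k else θ' k) - (P : ℝ)⁻¹ • ∑ j ∈ S, θt j‖ ^ 2
      ≤ 2 / (2 * m - P) * ∑ k, ‖(if k ∈ S then θt k else θ' k) - γbar‖ ^ 2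
        + 2 * (m / P) * ‖(P : ℝ)⁻¹ • ∑ k ∈ S, θt k - γbar‖ ^ 2 := by
    intro S _
    have h1 := Finset.sum_le_sum fun k (_ : k ∈ (Finset.univ : Finset (Fin m))) =>
      aux_young_s13 (if k ∈ S then θt k else θ' k) ((P : ℝ)⁻¹ • ∑ j ∈ S, θt j) γbar m P hP0 hPm'
    rw [Finset.sum_add_distrib, ← Finset.mul_sum, Finset.sum_const, Finset.card_univ,
      Fintype.card_fin, nsmul_eq_mul] at h1
    have h2 := mul_le_mul_of_nonneg_left h1 (inv_nonneg.mpr hm0.le)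
    refine h2.trans (le_of_eq ?_)
    have := hQ.ne'
    field_simp
  have hsum := Finset.sum_le_sum hS
  rw [Finset.sum_add_distrib, ← Finset.mul_sum, ← Finset.mul_sum,
    ← Finset.mul_sum, hcount] at hsum
  rw [div_le_iff₀ hN, ← Finset.mul_sum]
  refine hsum.trans (le_of_eq ?_)
  have h1 := hQ.ne'
  have h2 := hN.ne'
  generalize ((Finset.powersetCard P (Finset.univ : Finset (Fin m))).card : ℝ) = N at *
  generalize (∑ S ∈ Finset.powersetCard P (Finset.univ : Finset (Fin m)),
            ‖(P : ℝ)⁻¹ • ∑ k ∈ S, θt k - γbar‖ ^ 2) = X at *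
  field_simp
  ring
end

section
/- Under the FedDynOne process with each L_k additionally convex and with θ* a global minimizer of ℓ, if α ≥ 50·L then E[ ℓ( (1/T) ∑_{t=0}^{T−1} γ^t ) − ℓ(θ*) ] ≤ (1/T) · ( α·‖θ^0 − θ*‖² + (10/α)·(m/P) · (1/m) ∑_{k=1}^m ‖∇L_k(θ*)‖² ). -/
open scoped RealInnerProductSpace

section helpers
variable {E : Type*} [NormedAddCommGroup E] [InnerProductSpace ℝ E]

lemma fd_first_order [CompleteSpace E] (f : E → ℝ) (hf : Differentiable ℝ f)
    (hc : ConvexOn ℝ Set.univ f) (x y : E) : f x + ⟪gradient f x, y - x⟫ ≤ f y := by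
  have h1 : HasDerivAt (fun s : ℝ => f (AffineMap.lineMap x y s)) (⟪gradient f x, y - x⟫) 0 := by
    have h2 : HasFDerivAt f (fderiv ℝ f x) (AffineMap.lineMap x y (0 : ℝ)) := by
      simpa using (hf x).hasFDerivAt
    have h3 := h2.comp_hasDerivAt (0 : ℝ) (AffineMap.hasDerivAt_lineMap (a := x) (b := y))
    rw [inner_gradient_left]
    exact h3
  have hc2 : ConvexOn ℝ Set.univ (fun s : ℝ => f (AffineMap.lineMap x y s)) := by
    have := hc.comp_affineMap (AffineMap.lineMap x y : ℝ →ᵃ[ℝ] E)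
    exact this
  have := hc2.le_slope_of_hasDerivAt (Set.mem_univ 0) (Set.mem_univ 1) one_pos h1
  rw [slope_def_field] at this
  simp only [AffineMap.lineMap_apply_one, AffineMap.lineMap_apply_zero, sub_zero, div_one] at this
  linarith

lemma fd_upper [CompleteSpace E] (f : E → ℝ) (hf : Differentiable ℝ f)
    (hc : ConvexOn ℝ Set.univ f) (L : ℝ)
    (hs : ∀ x y, ‖gradient f x - gradient f y‖ ≤ L * ‖x - y‖) (x y : E) :
    f y ≤ f x + ⟪gradient f x, y - x⟫ + L * ‖y - x‖ ^ 2 := by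
  have h1 := fd_first_order f hf hc y x
  have h2 : ⟪gradient f y - gradient f x, y - x⟫ ≤ L * ‖y - x‖ ^ 2 := by
    refine (real_inner_le_norm _ _).trans ?_
    have := mul_le_mul_of_nonneg_right (hs y x) (norm_nonneg (y - x))
    nlinarith
  have h3 : ⟪gradient f y, x - y⟫ = - ⟪gradient f y, y - x⟫ := by
    rw [← inner_neg_right, neg_sub]
  rw [inner_sub_left] at h2
  linarith

lemma fd_bregman [CompleteSpace E] (f : E → ℝ) (hf : Differentiable ℝ f)
    (hc : ConvexOn ℝ Set.univ f) (L : ℝ) (hL : 0 < L)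
    (hs : ∀ x y, ‖gradient f x - gradient f y‖ ≤ L * ‖x - y‖) (x y : E) :
    f x + ⟪gradient f x, y - x⟫ + (4 * L)⁻¹ * ‖gradient f x - gradient f y‖ ^ 2 ≤ f y := by
  set v := gradient f y - gradient f x with hv
  have h1 := fd_first_order f hf hc x (y - (2 * L)⁻¹ • v)
  have h2 := fd_upper f hf hc L hs y (y - (2 * L)⁻¹ • v)
  have e1 : y - (2 * L)⁻¹ • v - x = (y - x) - (2 * L)⁻¹ • v := by abel
  have e2 : y - (2 * L)⁻¹ • v - y = - ((2 * L)⁻¹ • v) := by abel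
  rw [e1, inner_sub_right, inner_smul_right] at h1
  rw [e2, inner_neg_right, inner_smul_right, norm_neg, norm_smul, mul_pow, Real.norm_eq_abs,
    sq_abs] at h2
  have e3 : ⟪gradient f y, v⟫ - ⟪gradient f x, v⟫ = ‖v‖ ^ 2 := by
    rw [← inner_sub_left, ← hv, real_inner_self_eq_norm_sq]
  have e4 : ‖gradient f x - gradient f y‖ = ‖v‖ := norm_sub_rev _ _
  have e5 : L * ((2 * L)⁻¹ ^ 2 * ‖v‖ ^ 2) = (4 * L)⁻¹ * ‖v‖ ^ 2 := by
    field_simp; ring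
  have e6 : (2 * L)⁻¹ * ‖v‖ ^ 2 = 2 * ((4 * L)⁻¹ * ‖v‖ ^ 2) := by
    field_simp; ring
  have e7 : (2 * L)⁻¹ * ⟪gradient f y, v⟫ = (2 * L)⁻¹ * ⟪gradient f x, v⟫ + (2 * L)⁻¹ * ‖v‖ ^ 2 := by
    rw [← e3]; ring
  rw [e4]
  linarith

lemma fd_jensen_sq {ι : Type*} (s : Finset ι) (P : ℕ) (hP : 1 ≤ P) (hs : s.card = P) (w : ι → E) :
    ‖(P : ℝ)⁻¹ • ∑ k ∈ s, w k‖ ^ 2 ≤ (P : ℝ)⁻¹ * ∑ k ∈ s, ‖w k‖ ^ 2 := by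
  have hP' : (0 : ℝ) < P := by exact_mod_cast hP
  rw [norm_smul, mul_pow, Real.norm_eq_abs, sq_abs]
  have h1 : ‖∑ k ∈ s, w k‖ ^ 2 ≤ (∑ k ∈ s, ‖w k‖) ^ 2 := by
    gcongr; exact norm_sum_le _ _
  have h2 := sq_sum_le_card_mul_sum_sq (s := s) (f := fun k => ‖w k‖)
  rw [hs] at h2
  calc (P : ℝ)⁻¹ ^ 2 * ‖∑ k ∈ s, w k‖ ^ 2 ≤ (P : ℝ)⁻¹ ^ 2 * (P * ∑ k ∈ s, ‖w k‖ ^ 2) := by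
        gcongr; exact h1.trans h2
    _ = _ := by field_simp

lemma fd_sampling (m P : ℕ) (a : Fin m → ℝ) :
    (m : ℝ) * ∑ S : {S : Finset (Fin m) // S.card = P}, ∑ k ∈ S.1, a k
      = (Fintype.card {S : Finset (Fin m) // S.card = P} : ℝ) * P * ∑ k, a k := by
  set c : Fin m → ℝ := fun k => ∑ S : {S : Finset (Fin m) // S.card = P}, if k ∈ S.1 then 1 else 0
    with hc
  have h1 : ∀ b : Fin m → ℝ, ∑ S : {S : Finset (Fin m) // S.card = P}, ∑ k ∈ S.1, b k
      = ∑ k, c k * b k := by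
    intro b
    simp only [hc, Finset.sum_mul]
    rw [Finset.sum_comm]
    refine Finset.sum_congr rfl fun S _ => ?_
    simp [Finset.sum_ite_mem]
  have h2 : ∀ j k, c j = c k := by
    intro j k
    simp only [hc]
    refine Fintype.sum_equiv ((Equiv.finsetCongr (Equiv.swap j k)).subtypeEquiv ?_) _ _ ?_
    · intro S; simp
    · intro S
      simp
  have h3 : ∑ k, c k = (Fintype.card {S : Finset (Fin m) // S.card = P} : ℝ) * P := by
    have := h1 (fun _ => 1)
    simp only [mul_one] at this
    rw [← this]
    rw [Finset.sum_congr rfl (g := fun _ => (P : ℝ))]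
    · simp
    · intro S _
      simp [S.2]
  have h4 : ∀ k, (m : ℝ) * c k = (Fintype.card {S : Finset (Fin m) // S.card = P} : ℝ) * P := by
    intro k
    rw [← h3, Finset.sum_congr rfl (fun j _ => h2 j k)]
    simp
  rw [h1, Finset.mul_sum, Finset.mul_sum]
  refine Finset.sum_congr rfl fun k _ => ?_
  rw [← mul_assoc, h4]

lemma fd_resample {T : ℕ} {A : Type*} [Fintype A] (t : Fin T) (F : (Fin T → A) → ℝ) :
    ∑ ω : Fin T → A, ∑ S : A, F (Function.update ω t S) = (Fintype.card A : ℝ) * ∑ ω, F ω := by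
  have h1 : ∑ ω : Fin T → A, ∑ S : A, F (Function.update ω t S)
      = ∑ p : (Fin T → A) × A, F (Function.update p.1 t p.2) := by
    rw [Fintype.sum_prod_type]
  have h2 : ∑ p : (Fin T → A) × A, F (Function.update p.1 t p.2)
      = ∑ p : (Fin T → A) × A, F p.1 := by
    have hinv : Function.Involutive
        (fun p : (Fin T → A) × A => (Function.update p.1 t p.2, p.1 t)) := by
      intro p; simp
    exact Fintype.sum_equiv hinv.toPerm _ _ (fun p => rfl)
  rw [h1, h2, Fintype.sum_prod_type]
  simp [Finset.mul_sum]

lemma fd_grad_star [CompleteSpace E] (m : ℕ) (hm : 1 ≤ m) (Lk : Fin m → E → ℝ)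
    (hdiff : ∀ k, Differentiable ℝ (Lk k))
    (ℓ : E → ℝ) (hℓ : ∀ x, ℓ x = (m : ℝ)⁻¹ * ∑ k, Lk k x)
    (θstar : E) (hmin : ∀ x, ℓ θstar ≤ ℓ x) : ∑ k, gradient (Lk k) θstar = 0 := by
  have hm' : (0 : ℝ) < m := by exact_mod_cast hm
  have h1 : IsLocalMin (fun x => ∑ k, Lk k x) θstar := by
    refine Filter.Eventually.of_forall fun x => ?_
    have := hmin x
    rw [hℓ, hℓ] at this
    exact le_of_mul_le_mul_left this (inv_pos.2 hm')
  have h2 : HasFDerivAt (fun x => ∑ k, Lk k x) (∑ k, fderiv ℝ (Lk k) θstar) θstar :=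
    HasFDerivAt.fun_sum fun k _ => (hdiff k θstar).hasFDerivAt
  have h3 := h1.hasFDerivAt_eq_zero h2
  apply ext_inner_right ℝ
  intro v
  rw [sum_inner, inner_zero_left]
  simp only [inner_gradient_left]
  simpa using congrArg (fun g => g v) h3

/-- One step of the Lyapunov argument, mean of the increments. -/
lemma fd_mean_step [CompleteSpace E] (m : ℕ) (hm : 1 ≤ m)
    (α L : ℝ) (hα : 0 < α) (hL : 0 < L) (hαL : 50 * L ≤ α)
    (Lk : Fin m → E → ℝ)
    (hdiff : ∀ k, Differentiable ℝ (Lk k))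
    (hconv : ∀ k, ConvexOn ℝ Set.univ (Lk k))
    (hsmooth : ∀ k x y, ‖gradient (Lk k) x - gradient (Lk k) y‖ ≤ L * ‖x - y‖)
    (ℓ : E → ℝ) (hℓ : ∀ x, ℓ x = (m : ℝ)⁻¹ * ∑ k, Lk k x)
    (z : E) (hmin : ∀ x, ℓ z ≤ ℓ x)
    (γ θ h : E) (hk : Fin m → E) (hh : ∑ k, hk k = (m : ℝ) • h) (hθ : θ = γ - α⁻¹ • h) :
    ∑ k, (2 * ⟪γ - z, -(α⁻¹ • (gradient (Lk k) θ - hk k + h))⟫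
        + ‖-(α⁻¹ • (gradient (Lk k) θ - hk k + h))‖ ^ 2
        + 3 / α ^ 2 * (‖gradient (Lk k) θ - gradient (Lk k) z‖ ^ 2
            - ‖hk k - gradient (Lk k) z‖ ^ 2))
      ≤ - (m * (2 / α * (ℓ γ - ℓ z))) := by
  have hm' : (0 : ℝ) < m := by exact_mod_cast hm
  have hstar := fd_grad_star m hm Lk hdiff ℓ hℓ z hmin
  -- per-device bound
  have hterm : ∀ k, 2 * ⟪γ - z, -(α⁻¹ • (gradient (Lk k) θ - hk k + h))⟫
        + ‖-(α⁻¹ • (gradient (Lk k) θ - hk k + h))‖ ^ 2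
        + 3 / α ^ 2 * (‖gradient (Lk k) θ - gradient (Lk k) z‖ ^ 2
            - ‖hk k - gradient (Lk k) z‖ ^ 2)
      ≤ - (2 / α) * (Lk k γ - Lk k z) + 2 / α * ⟪γ - z, hk k - h⟫
        + (3 / α ^ 2) * (‖h‖ ^ 2 - ‖hk k - gradient (Lk k) z‖ ^ 2)
        + 2 / α ^ 2 * (‖hk k - gradient (Lk k) z - h‖ ^ 2 - ‖h‖ ^ 2) := by
    intro k
    set g := gradient (Lk k) θ with hg
    set gs := gradient (Lk k) z with hgs
    have hb := fd_bregman (Lk k) (hdiff k) (hconv k) L hL (hsmooth k) θ z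
    have hu := fd_upper (Lk k) (hdiff k) (hconv k) L (hsmooth k) θ γ
    rw [← hg] at hb hu
    rw [← hgs] at hb
    have e0 : γ - θ = α⁻¹ • h := by rw [hθ]; abel
    have e1 : ⟪g, γ - z⟫ = ⟪g, γ - θ⟫ - ⟪g, z - θ⟫ := by
      rw [← inner_sub_right]; congr 1; abel
    have hu2 : L * ‖γ - θ‖ ^ 2 ≤ (50 * α)⁻¹ * ‖h‖ ^ 2 := by
      rw [e0, norm_smul, mul_pow, Real.norm_eq_abs, sq_abs, ← mul_assoc]
      refine mul_le_mul_of_nonneg_right ?_ (sq_nonneg _)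
      field_simp
      linarith
    have hb2 : (25 / 2 / α) * ‖g - gs‖ ^ 2 ≤ (4 * L)⁻¹ * ‖g - gs‖ ^ 2 := by
      refine mul_le_mul_of_nonneg_right ?_ (sq_nonneg _)
      field_simp
      linarith
    have e2 : ⟪γ - z, -(α⁻¹ • (g - hk k + h))⟫ = α⁻¹ * (⟪γ - z, hk k - h⟫ - ⟪g, γ - z⟫) := by
      have : -(α⁻¹ • (g - hk k + h)) = α⁻¹ • ((hk k - h) - g) := by
        rw [← smul_neg]; congr 1; abel
      rw [this, inner_smul_right, inner_sub_right, real_inner_comm g]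
    have e3 : ‖-(α⁻¹ • (g - hk k + h))‖ ^ 2
        ≤ 2 / α ^ 2 * (‖g - gs‖ ^ 2 + ‖hk k - gs - h‖ ^ 2) := by
      rw [norm_neg, norm_smul, mul_pow, Real.norm_eq_abs, sq_abs]
      have : g - hk k + h = (g - gs) - (hk k - gs - h) := by abel
      rw [this]
      have h5 := norm_sub_le (g - gs) (hk k - gs - h)
      have h6 : ‖(g - gs) - (hk k - gs - h)‖ ^ 2 ≤ 2 * (‖g - gs‖ ^ 2 + ‖hk k - gs - h‖ ^ 2) := by
        nlinarith [norm_nonneg ((g - gs) - (hk k - gs - h)), sq_nonneg (‖g - gs‖ - ‖hk k - gs - h‖)]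
      calc α⁻¹ ^ 2 * ‖(g - gs) - (hk k - gs - h)‖ ^ 2
          ≤ α⁻¹ ^ 2 * (2 * (‖g - gs‖ ^ 2 + ‖hk k - gs - h‖ ^ 2)) := by gcongr
        _ = _ := by field_simp
    have h7 : Lk k γ - Lk k z - (50 * α)⁻¹ * ‖h‖ ^ 2 + (25 / 2 / α) * ‖g - gs‖ ^ 2 ≤ ⟪g, γ - z⟫ := by
      linarith
    rw [e2]
    have h8 := mul_le_mul_of_nonneg_left h7 (by positivity : 0 ≤ 2 / α)
    have e4 : 2 / α * (Lk k γ - Lk k z - (50 * α)⁻¹ * ‖h‖ ^ 2 + (25 / 2 / α) * ‖g - gs‖ ^ 2)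
        = 2 / α * (Lk k γ - Lk k z) - (1 / 25) * (‖h‖ ^ 2 / α ^ 2) + 25 * (‖g - gs‖ ^ 2 / α ^ 2) := by
      field_simp; ring
    have n1 : 0 ≤ ‖g - gs‖ ^ 2 / α ^ 2 := by positivity
    have n2 : 0 ≤ ‖h‖ ^ 2 / α ^ 2 := by positivity
    have e5 : 2 * (α⁻¹ * (⟪γ - z, hk k - h⟫ - ⟪g, γ - z⟫))
        = 2 / α * ⟪γ - z, hk k - h⟫ - 2 / α * ⟪g, γ - z⟫ := by ring
    rw [e5]
    rw [e4] at h8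
    have e6 : ∀ x : ℝ, 3 / α ^ 2 * x = 3 * (x / α ^ 2) := fun x => by ring
    have e7 : ∀ x : ℝ, 2 / α ^ 2 * x = 2 * (x / α ^ 2) := fun x => by ring
    simp only [e6, e7, sub_div, add_div] at e3 ⊢
    linarith
  refine (Finset.sum_le_sum fun k _ => hterm k).trans ?_
  have s1 : ∑ k, (hk k - h) = 0 := by
    rw [Finset.sum_sub_distrib, hh]; simp [Nat.cast_smul_eq_nsmul]
  have s2 : ∑ k, ⟪γ - z, hk k - h⟫ = 0 := by rw [← inner_sum, s1, inner_zero_right]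
  have s3 : ∑ k, (hk k - gradient (Lk k) z) = (m : ℝ) • h := by
    rw [Finset.sum_sub_distrib, hh, hstar, sub_zero]
  have s4 : ∑ k, ‖hk k - gradient (Lk k) z - h‖ ^ 2
      = ∑ k, ‖hk k - gradient (Lk k) z‖ ^ 2 - m * ‖h‖ ^ 2 := by
    simp only [norm_sub_sq_real _ h, Finset.sum_add_distrib, Finset.sum_sub_distrib]
    rw [← Finset.mul_sum, ← sum_inner, s3, inner_smul_left, real_inner_self_eq_norm_sq]
    simp; ring
  have s5 : ∑ k, (Lk k γ - Lk k z) = m * (ℓ γ - ℓ z) := by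
    rw [hℓ, hℓ, Finset.sum_sub_distrib]; field_simp
  have s6 : m * ‖h‖ ^ 2 ≤ ∑ k, ‖hk k - gradient (Lk k) z‖ ^ 2 := by
    have : 0 ≤ ∑ k, ‖hk k - gradient (Lk k) z - h‖ ^ 2 := by positivity
    linarith
  simp only [Finset.sum_add_distrib, ← Finset.mul_sum, Finset.sum_sub_distrib, s2, s4]
  rw [← Finset.sum_sub_distrib, s5]
  simp only [Finset.sum_const, Finset.card_univ, Fintype.card_fin, nsmul_eq_mul]
  set C := ∑ k, ‖hk k - gradient (Lk k) z‖ ^ 2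
  set q := m * ‖h‖ ^ 2
  have n3 : 0 ≤ 1 / α ^ 2 * (C - q) := mul_nonneg (by positivity) (by linarith)
  have n4 : 0 ≤ 1 / α ^ 2 * q := by positivity
  have e8 : 3 / α ^ 2 * (q - C) + 2 / α ^ 2 * (C - q - q)
      = - (1 / α ^ 2 * (C - q)) - 2 * (1 / α ^ 2 * q) := by ring
  linarith [e8]

end helpers

/-- FedDynOne convergence rate, convex case. -/
theorem feddynone_convergence_convex
    (d m P T : ℕ) (hd : 1 ≤ d) (hm : 1 ≤ m) (hP1 : 1 ≤ P) (hPm : P ≤ m) (hT : 1 ≤ T)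
    (α L : ℝ) (hα : 0 < α) (hL : 0 < L) (hαL : 50 * L ≤ α)
    (Lk : Fin m → EuclideanSpace ℝ (Fin d) → ℝ)
    (hdiff : ∀ k, Differentiable ℝ (Lk k))
    (hconv : ∀ k, ConvexOn ℝ Set.univ (Lk k))
    (hsmooth : ∀ k x y, ‖gradient (Lk k) x - gradient (Lk k) y‖ ≤ L * ‖x - y‖)
    (ℓ : EuclideanSpace ℝ (Fin d) → ℝ)
    (hℓ : ∀ x, ℓ x = (m : ℝ)⁻¹ * ∑ k, Lk k x)
    (θstar : EuclideanSpace ℝ (Fin d)) (hmin : ∀ x, ℓ θstar ≤ ℓ x)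
    (θ0 : EuclideanSpace ℝ (Fin d))
    -- the FedDynOne process, as functions of the random sequence of active sets
    (θ : (Fin T → {S : Finset (Fin m) // S.card = P}) → ℕ → EuclideanSpace ℝ (Fin d))
    (θdev : (Fin T → {S : Finset (Fin m) // S.card = P}) → ℕ → Fin m → EuclideanSpace ℝ (Fin d))
    (hk : (Fin T → {S : Finset (Fin m) // S.card = P}) → ℕ → Fin m → EuclideanSpace ℝ (Fin d))
    (h : (Fin T → {S : Finset (Fin m) // S.card = P}) → ℕ → EuclideanSpace ℝ (Fin d))
    (γ : (Fin T → {S : Finset (Fin m) // S.card = P}) → ℕ → EuclideanSpace ℝ (Fin d))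
    (hθ0 : ∀ ω, θ ω 0 = θ0)
    (hhk0 : ∀ ω k, hk ω 0 k = 0)
    (hh0 : ∀ ω, h ω 0 = 0)
    -- active devices take one gradient step
    (hdevupd : ∀ ω (t : Fin T), ∀ k ∈ (ω t).1,
      θdev ω (t.1 + 1) k = θ ω t.1 - α⁻¹ • (gradient (Lk k) (θ ω t.1) - hk ω t.1 k))
    (hhkupd : ∀ ω (t : Fin T), ∀ k ∈ (ω t).1,
      hk ω (t.1 + 1) k = hk ω t.1 k - α • (θdev ω (t.1 + 1) k - θ ω t.1))
    (hstaleθ : ∀ ω (t : Fin T), ∀ k ∉ (ω t).1, θdev ω (t.1 + 1) k = θdev ω t.1 k)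
    (hstalehk : ∀ ω (t : Fin T), ∀ k ∉ (ω t).1, hk ω (t.1 + 1) k = hk ω t.1 k)
    (hhupd : ∀ ω (t : Fin T),
      h ω (t.1 + 1) = h ω t.1 - (α / m) • ∑ k ∈ (ω t).1, (θdev ω (t.1 + 1) k - θ ω t.1))
    (hθupd : ∀ ω (t : Fin T),
      θ ω (t.1 + 1) = (P : ℝ)⁻¹ • ∑ k ∈ (ω t).1, θdev ω (t.1 + 1) k - α⁻¹ • h ω (t.1 + 1))
    (hγ0 : ∀ ω, γ ω 0 = θ0)
    (hγ : ∀ ω (t : Fin T),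
      γ ω (t.1 + 1) = (P : ℝ)⁻¹ • ∑ k ∈ (ω t).1, θdev ω (t.1 + 1) k) :
    (∑ ω : (Fin T → {S : Finset (Fin m) // S.card = P}),
        (ℓ ((T : ℝ)⁻¹ • ∑ t ∈ Finset.range T, γ ω t) - ℓ θstar)) /
      (Fintype.card (Fin T → {S : Finset (Fin m) // S.card = P}) : ℝ) ≤
    (T : ℝ)⁻¹ * (α * ‖θ0 - θstar‖ ^ 2 +
      10 / α * ((m : ℝ) / P) * ((m : ℝ)⁻¹ * ∑ k, ‖gradient (Lk k) θstar‖ ^ 2)) := by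
  classical
  have hm' : (0 : ℝ) < m := by exact_mod_cast hm
  have hP' : (0 : ℝ) < P := by exact_mod_cast hP1
  have hT' : (0 : ℝ) < T := by exact_mod_cast hT
  have hstep : ∀ ω (t : Fin T), ∀ k ∈ (ω t).1,
      θdev ω (t.1 + 1) k - θ ω t.1 = -(α⁻¹ • (gradient (Lk k) (θ ω t.1) - hk ω t.1 k)) := by
    intro ω t k hkS
    rw [hdevupd ω t k hkS]; abel
  have hkval : ∀ ω (t : Fin T), ∀ k ∈ (ω t).1,
      hk ω (t.1 + 1) k = gradient (Lk k) (θ ω t.1) := by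
    intro ω t k hkS
    rw [hhkupd ω t k hkS, hstep ω t k hkS, smul_neg, smul_inv_smul₀ hα.ne']; abel
  have hhval : ∀ ω (t : Fin T), h ω (t.1 + 1) = h ω t.1
      + (m : ℝ)⁻¹ • ∑ k ∈ (ω t).1, (gradient (Lk k) (θ ω t.1) - hk ω t.1 k) := by
    intro ω t
    rw [hhupd ω t, Finset.sum_congr rfl (fun k hkS => hstep ω t k hkS), Finset.sum_neg_distrib,
      ← Finset.smul_sum, smul_neg, sub_neg_eq_add, smul_smul]
    congr 2
    field_simp
  have hkite : ∀ ω (t : Fin T) k, hk ω (t.1 + 1) k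
      = if k ∈ (ω t).1 then gradient (Lk k) (θ ω t.1) else hk ω t.1 k := by
    intro ω t k
    split_ifs with hkS
    · exact hkval ω t k hkS
    · exact hstalehk ω t k hkS
  have hsum : ∀ ω (t : ℕ), t ≤ T → ∑ k, hk ω t k = (m : ℝ) • h ω t := by
    intro ω t
    induction t with
    | zero => intro _; simp [hhk0, hh0]
    | succ t ih =>
      intro ht
      have ih' := ih (by omega)
      have e1 := hhval ω ⟨t, by omega⟩
      have e2 := hkite ω ⟨t, by omega⟩
      simp only at e1 e2
      rw [e1, smul_add, smul_inv_smul₀ hm'.ne', ← ih', ← Finset.univ_inter (ω ⟨t, by omega⟩).1,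
        ← Finset.sum_ite_mem, ← Finset.sum_add_distrib]
      refine Finset.sum_congr rfl fun k _ => ?_
      rw [e2]
      split_ifs <;> simp
  have hθγ : ∀ ω (t : ℕ), t ≤ T → θ ω t = γ ω t - α⁻¹ • h ω t := by
    intro ω t
    cases t with
    | zero => intro _; simp [hθ0, hγ0, hh0]
    | succ t =>
      intro ht
      have e1 := hθupd ω ⟨t, by omega⟩
      have e2 := hγ ω ⟨t, by omega⟩
      simp only at e1 e2
      rw [e1, e2]
  have hγstep : ∀ ω (t : Fin T), γ ω (t.1 + 1) = γ ω t.1 + (P : ℝ)⁻¹ • ∑ k ∈ (ω t).1,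
      -(α⁻¹ • (gradient (Lk k) (θ ω t.1) - hk ω t.1 k + h ω t.1)) := by
    intro ω t
    have e1 : ∀ k ∈ (ω t).1, θdev ω (t.1 + 1) k = γ ω t.1 +
        -(α⁻¹ • (gradient (Lk k) (θ ω t.1) - hk ω t.1 k + h ω t.1)) := by
      intro k hkS
      have e0 : γ ω t.1 = θ ω t.1 + α⁻¹ • h ω t.1 := by rw [hθγ ω t.1 t.2.le]; abel
      rw [hdevupd ω t k hkS, smul_add, e0]
      abel
    rw [hγ ω t, Finset.sum_congr rfl e1, Finset.sum_add_distrib, smul_add, Finset.sum_const,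
      (ω t).2, ← Nat.cast_smul_eq_nsmul ℝ, inv_smul_smul₀ hP'.ne']
  -- Lyapunov function and increments
  set b : (Fin T → {S : Finset (Fin m) // S.card = P}) → ℕ → Fin m → ℝ := fun ω t k =>
    2 * ⟪γ ω t - θstar, -(α⁻¹ • (gradient (Lk k) (θ ω t) - hk ω t k + h ω t))⟫
        + ‖-(α⁻¹ • (gradient (Lk k) (θ ω t) - hk ω t k + h ω t))‖ ^ 2
        + 3 / α ^ 2 * (‖gradient (Lk k) (θ ω t) - gradient (Lk k) θstar‖ ^ 2
            - ‖hk ω t k - gradient (Lk k) θstar‖ ^ 2) with hb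
  set V : (Fin T → {S : Finset (Fin m) // S.card = P}) → ℕ → ℝ := fun ω t =>
    ‖γ ω t - θstar‖ ^ 2
      + (P : ℝ)⁻¹ * (3 / α ^ 2 * ∑ k, ‖hk ω t k - gradient (Lk k) θstar‖ ^ 2) with hV
  have hVstep : ∀ ω (t : Fin T), V ω (t.1 + 1) ≤ V ω t.1 + (P : ℝ)⁻¹ * ∑ k ∈ (ω t).1, b ω t.1 k := by
    intro ω t
    simp only [hV, hb]
    have e1 : ∑ k, ‖hk ω (t.1 + 1) k - gradient (Lk k) θstar‖ ^ 2
        = ∑ k, ‖hk ω t.1 k - gradient (Lk k) θstar‖ ^ 2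
          + ∑ k ∈ (ω t).1, (‖gradient (Lk k) (θ ω t) - gradient (Lk k) θstar‖ ^ 2
            - ‖hk ω t k - gradient (Lk k) θstar‖ ^ 2) := by
      rw [← Finset.univ_inter (ω t).1, ← Finset.sum_ite_mem, ← Finset.sum_add_distrib]
      refine Finset.sum_congr rfl fun k _ => ?_
      rw [hkite]
      split_ifs <;> simp
    have e2 := fd_jensen_sq (ω t).1 P hP1 (ω t).2
      (fun k => -(α⁻¹ • (gradient (Lk k) (θ ω t.1) - hk ω t.1 k + h ω t.1)))
    rw [e1, hγstep, add_sub_right_comm, norm_add_sq_real, inner_smul_right, inner_sum]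
    simp only [Finset.sum_add_distrib, ← Finset.mul_sum]
    simp only [mul_add]
    linarith
  have hmean : ∀ ω (t : Fin T), ∑ k, b ω t.1 k ≤ -(m * (2 / α * (ℓ (γ ω t.1) - ℓ θstar))) := by
    intro ω t
    exact fd_mean_step m hm α L hα hL hαL Lk hdiff hconv hsmooth ℓ hℓ θstar hmin _ _ _ _
      (hsum ω t.1 t.2.le) (hθγ ω t.1 t.2.le)
  -- non-anticipation
  have hna : ∀ (t : Fin T) ω S (s : ℕ), s ≤ t.1 →
      θ (Function.update ω t S) s = θ ω s ∧ hk (Function.update ω t S) s = hk ω s ∧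
      h (Function.update ω t S) s = h ω s ∧ γ (Function.update ω t S) s = γ ω s := by
    intro t ω S s
    induction s with
    | zero =>
      intro _
      refine ⟨by simp [hθ0], ?_, by simp [hh0], by simp [hγ0]⟩
      funext k; simp [hhk0]
    | succ s ih =>
      intro hs
      obtain ⟨i1, i2, i3, i4⟩ := ih (by omega)
      have hsT : s < T := by have := t.2; omega
      have hne : (⟨s, hsT⟩ : Fin T) ≠ t := by
        intro hc
        have := congrArg Fin.val hc
        simp only at this
        omega
      have hω : (Function.update ω t S) ⟨s, hsT⟩ = ω ⟨s, hsT⟩ := Function.update_of_ne hne _ _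
      have j2 : hk (Function.update ω t S) (s + 1) = hk ω (s + 1) := by
        funext k
        have e1 := hkite ω ⟨s, hsT⟩ k
        have e2 := hkite (Function.update ω t S) ⟨s, hsT⟩ k
        rw [hω] at e2
        simp only [i1, i2] at e1 e2
        rw [e1, e2]
      have j3 : h (Function.update ω t S) (s + 1) = h ω (s + 1) := by
        have e1 := hhval ω ⟨s, hsT⟩
        have e2 := hhval (Function.update ω t S) ⟨s, hsT⟩
        rw [hω] at e2
        simp only [i1, i2, i3] at e1 e2
        rw [e1, e2]
      have j4 : γ (Function.update ω t S) (s + 1) = γ ω (s + 1) := by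
        have e1 := hγstep ω ⟨s, hsT⟩
        have e2 := hγstep (Function.update ω t S) ⟨s, hsT⟩
        rw [hω] at e2
        simp only [i1, i2, i3, i4] at e1 e2
        rw [e1, e2]
      refine ⟨?_, j2, j3, j4⟩
      rw [hθγ _ _ (by omega), hθγ _ _ (by omega), j3, j4]
  set N : ℝ := (Fintype.card {S : Finset (Fin m) // S.card = P} : ℝ) with hN
  have hNpos : 0 < N := by
    obtain ⟨S, _, hS⟩ := Finset.exists_subset_card_eq (s := (Finset.univ : Finset (Fin m))) (n := P)
      (by simpa using hPm)
    have : Nonempty {S : Finset (Fin m) // S.card = P} := ⟨⟨S, hS⟩⟩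
    rw [hN]
    exact_mod_cast Fintype.card_pos
  have hEstep : ∀ t : Fin T, ∑ ω, V ω (t.1 + 1) ≤ ∑ ω, V ω t.1
      - 2 / α * ∑ ω, (ℓ (γ ω t.1) - ℓ θstar) := by
    intro t
    have e1 := fd_resample t (fun ω => ∑ k ∈ (ω t).1, b ω t.1 k)
    have e2 : ∀ ω, ∑ S, ∑ k ∈ ((Function.update ω t S) t).1, b (Function.update ω t S) t.1 k
        ≤ N * P * (-(2 / α * (ℓ (γ ω t.1) - ℓ θstar))) := by
      intro ω
      have e3 : ∀ S k, b (Function.update ω t S) t.1 k = b ω t.1 k := by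
        intro S k
        obtain ⟨i1, i2, i3, i4⟩ := hna t ω S t.1 le_rfl
        simp only [hb, i1, i2, i3, i4]
      simp only [e3, Function.update_self]
      have e4 := fd_sampling m P (b ω t.1)
      have e5 := hmean ω t
      refine le_of_mul_le_mul_left ?_ hm'
      rw [e4]
      have := mul_le_mul_of_nonneg_left e5 (by positivity : 0 ≤ N * P)
      linarith
    have e3 := Finset.sum_le_sum fun ω (_ : ω ∈ Finset.univ) => e2 ω
    rw [e1, ← Finset.mul_sum, Finset.sum_neg_distrib, ← Finset.mul_sum, mul_assoc] at e3
    have e4 := le_of_mul_le_mul_left e3 hNpos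
    have e5 := Finset.sum_le_sum fun ω (_ : ω ∈ Finset.univ) => hVstep ω t
    have e7 : ∑ ω, (V ω t.1 + (P : ℝ)⁻¹ * ∑ k ∈ (ω t).1, b ω t.1 k)
        = ∑ ω, V ω t.1 + (P : ℝ)⁻¹ * ∑ ω, ∑ k ∈ (ω t).1, b ω t.1 k := by
      rw [Finset.sum_add_distrib, ← Finset.mul_sum]
    rw [e7] at e5
    have e6 := mul_le_mul_of_nonneg_left e4 (inv_nonneg.2 hP'.le)
    rw [inv_mul_cancel_left₀ hP'.ne'] at e6
    linarith
  have htel : ∀ n : ℕ, n ≤ T → ∑ ω, V ω n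
      + 2 / α * ∑ t ∈ Finset.range n, ∑ ω, (ℓ (γ ω t) - ℓ θstar) ≤ ∑ ω, V ω 0 := by
    intro n
    induction n with
    | zero => intro _; simp
    | succ n ih =>
      intro hn
      have := ih (by omega)
      have e := hEstep ⟨n, by omega⟩
      simp only at e
      rw [Finset.sum_range_succ, mul_add]
      linarith
  have hVT : 0 ≤ ∑ ω, V ω T := Finset.sum_nonneg fun ω _ => by simp only [hV]; positivity
  have hmain := htel T le_rfl
  set M : ℝ := (Fintype.card (Fin T → {S : Finset (Fin m) // S.card = P}) : ℝ) with hM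
  have hMpos : 0 < M := by
    rw [hM, Fintype.card_fun]
    push_cast
    exact pow_pos hNpos _
  set G : ℝ := ∑ k, ‖gradient (Lk k) θstar‖ ^ 2 with hG
  have hG0 : 0 ≤ G := by positivity
  have hV0 : ∑ ω, V ω 0 = M * (‖θ0 - θstar‖ ^ 2 + (P : ℝ)⁻¹ * (3 / α ^ 2 * G)) := by
    simp only [hV, hγ0, hhk0, zero_sub, norm_neg, Finset.sum_const, Finset.card_univ,
      nsmul_eq_mul, hM, hG]
  have hℓconv : ConvexOn ℝ Set.univ ℓ := by
    have e1 : ConvexOn ℝ Set.univ (∑ k, Lk k) :=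
      Finset.sum_induction _ (fun f => ConvexOn ℝ Set.univ f) (fun _ _ ha hb => ha.add hb)
        (convexOn_const 0 convex_univ) (fun k _ => hconv k)
    have e2 := e1.smul (inv_nonneg.2 hm'.le)
    have e3 : ℓ = fun x => (m : ℝ)⁻¹ • (∑ k, Lk k) x := by
      funext x
      simp [hℓ]
    rw [e3]
    exact e2
  have hJ : ∀ ω, ℓ ((T : ℝ)⁻¹ • ∑ t ∈ Finset.range T, γ ω t) - ℓ θstar
      ≤ (T : ℝ)⁻¹ * ∑ t ∈ Finset.range T, (ℓ (γ ω t) - ℓ θstar) := by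
    intro ω
    have e1 := hℓconv.map_sum_le (t := Finset.range T) (w := fun _ => (T : ℝ)⁻¹) (p := γ ω)
      (fun _ _ => inv_nonneg.2 hT'.le) (by simp [hT'.ne']) (fun _ _ => Set.mem_univ _)
    rw [← Finset.smul_sum] at e1
    simp only [smul_eq_mul] at e1
    rw [← Finset.mul_sum] at e1
    rw [Finset.sum_sub_distrib, mul_sub]
    simp only [Finset.sum_const, Finset.card_range, nsmul_eq_mul]
    rw [inv_mul_cancel_left₀ hT'.ne']
    linarith
  have hJs := Finset.sum_le_sum fun ω (_ : ω ∈ Finset.univ) => hJ ω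
  rw [← Finset.mul_sum, Finset.sum_comm] at hJs
  set D : ℝ := ∑ t ∈ Finset.range T, ∑ ω, (ℓ (γ ω t) - ℓ θstar) with hD
  rw [hV0] at hmain
  have hDle : D ≤ α / 2 * (M * (‖θ0 - θstar‖ ^ 2 + (P : ℝ)⁻¹ * (3 / α ^ 2 * G))) := by
    have e0 : 2 / α * D ≤ M * (‖θ0 - θstar‖ ^ 2 + (P : ℝ)⁻¹ * (3 / α ^ 2 * G)) := by linarith
    have := mul_le_mul_of_nonneg_left e0 (by positivity : 0 ≤ α / 2)
    have e : α / 2 * (2 / α * D) = D := by field_simp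
    rw [e] at this
    exact this
  rw [div_le_iff₀ hMpos]
  refine hJs.trans ?_
  rw [mul_assoc]
  refine mul_le_mul_of_nonneg_left (hDle.trans ?_) (inv_nonneg.2 hT'.le)
  have e1 : α / 2 * (M * (‖θ0 - θstar‖ ^ 2 + (P : ℝ)⁻¹ * (3 / α ^ 2 * G)))
      = (α / 2 * ‖θ0 - θstar‖ ^ 2 + 3 / 2 * (G / (α * P))) * M := by
    field_simp
  have e2 : 10 / α * ((m : ℝ) / P) * ((m : ℝ)⁻¹ * G) = 10 * (G / (α * P)) := by
    field_simp
  rw [e1, e2]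
  refine mul_le_mul_of_nonneg_right ?_ hMpos.le
  have n1 : 0 ≤ G / (α * P) := by positivity
  have n2 : 0 ≤ α * ‖θ0 - θstar‖ ^ 2 := by positivity
  linarith
end

section
/- (Lemma: FedDynOne bound on device dispersion, convex case.) With ε = (1/m) ∑_{k=1}^m ‖θ̃_k − γ̄‖² and A = (1/m) ∑_{k=1}^m ‖h_k − ∇L_k(θ*)‖², the inequality ε ≤ ( 8/α² + 4L²/α⁴ )·A + (8L/α²)·( ℓ(γ̄) − ℓ(θ*) ) holds. -/
open scoped RealInnerProductSpace

section Helpers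

variable {d : ℕ}

lemma fd_line_deriv (f : EuclideanSpace ℝ (Fin d) → ℝ) (hf : Differentiable ℝ f)
    (x v : EuclideanSpace ℝ (Fin d)) (t : ℝ) :
    HasDerivAt (fun t : ℝ => f (x + t • v)) (inner ℝ (gradient f (x + t • v)) v) t := by
  have h1 : HasDerivAt (fun t : ℝ => x + t • v) v t := by
    simpa using ((hasDerivAt_id t).smul_const v).const_add x
  have h2 := ((hf (x + t • v)).hasGradientAt.hasFDerivAt).comp_hasDerivAt t h1
  exact h2

lemma fd_descent (f : EuclideanSpace ℝ (Fin d) → ℝ) (hf : Differentiable ℝ f) (L : ℝ)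
    (hs : ∀ x y, ‖gradient f x - gradient f y‖ ≤ L * ‖x - y‖)
    (x v : EuclideanSpace ℝ (Fin d)) :
    f (x + v) ≤ f x + inner ℝ (gradient f x) v + L / 2 * ‖v‖ ^ 2 := by
  set ψ : ℝ → ℝ := fun t =>
    f (x + t • v) - t * inner ℝ (gradient f x) v - t ^ 2 * (L / 2 * ‖v‖ ^ 2) with hψ
  have hd : ∀ t, HasDerivAt ψ (inner ℝ (gradient f (x + t • v)) v
      - inner ℝ (gradient f x) v - 2 * t * (L / 2 * ‖v‖ ^ 2)) t := by
    intro t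
    have h1 := fd_line_deriv f hf x v t
    have h2 := (hasDerivAt_id t).mul_const (inner ℝ (gradient f x) v)
    have h3 := (hasDerivAt_pow 2 t).mul_const (L / 2 * ‖v‖ ^ 2)
    refine ((h1.sub h2).sub h3).congr_deriv ?_
    norm_num
  have hanti : AntitoneOn ψ (Set.Ici 0) := by
    apply antitoneOn_of_deriv_nonpos (convex_Ici 0)
    · exact fun t _ => (hd t).continuousAt.continuousWithinAt
    · exact fun t _ => (hd t).differentiableAt.differentiableWithinAt
    · intro t ht
      rw [interior_Ici] at ht
      have ht : 0 < t := ht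
      rw [(hd t).deriv, ← inner_sub_left]
      have h1 := real_inner_le_norm (gradient f (x + t • v) - gradient f x) v
      have h2 := hs (x + t • v) x
      rw [add_sub_cancel_left, norm_smul, Real.norm_eq_abs, abs_of_pos ht] at h2
      have h3 := mul_le_mul_of_nonneg_right h2 (norm_nonneg v)
      nlinarith
  have := hanti (by simp : (0:ℝ) ∈ Set.Ici 0) (by simp : (1:ℝ) ∈ Set.Ici 0) zero_le_one
  simp only [hψ, one_smul, zero_smul, add_zero] at this
  linarith

lemma fd_convex (f : EuclideanSpace ℝ (Fin d) → ℝ) (hf : Differentiable ℝ f)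
    (hc : ConvexOn ℝ Set.univ f) (y z : EuclideanSpace ℝ (Fin d)) :
    f y + inner ℝ (gradient f y) (z - y) ≤ f z := by
  have h1 := fd_line_deriv f hf y (z - y) 0
  have hc' : ConvexOn ℝ Set.univ (fun t : ℝ => f (y + t • (z - y))) := by
    have := hc.comp_affineMap (AffineMap.lineMap y z : ℝ →ᵃ[ℝ] EuclideanSpace ℝ (Fin d))
    rw [Set.preimage_univ] at this
    refine this.congr ?_
    intro t _
    simp [AffineMap.lineMap_apply, add_comm]
  have := hc'.le_slope_of_hasDerivAt (Set.mem_univ 0) (Set.mem_univ 1) zero_lt_one h1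
  simp only [slope_def_field, zero_smul, one_smul, add_zero, sub_zero, div_one,
    add_sub_cancel] at this
  linarith

lemma fd_cocoercive (f : EuclideanSpace ℝ (Fin d) → ℝ) (hf : Differentiable ℝ f)
    (hc : ConvexOn ℝ Set.univ f) (L : ℝ) (hL : 0 < L)
    (hs : ∀ x y, ‖gradient f x - gradient f y‖ ≤ L * ‖x - y‖)
    (x y : EuclideanSpace ℝ (Fin d)) :
    ‖gradient f x - gradient f y‖ ^ 2 ≤
      2 * L * (f x - f y - inner ℝ (gradient f y) (x - y)) := by
  set w := gradient f x - gradient f y with hw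
  have h1 := fd_descent f hf L hs x (-(L⁻¹ • w))
  have h2 := fd_convex f hf hc y (x + -(L⁻¹ • w))
  have e : x + -(L⁻¹ • w) - y = (x - y) - L⁻¹ • w := by abel
  rw [e, inner_sub_right, inner_smul_right] at h2
  rw [inner_neg_right, inner_smul_right, norm_neg, norm_smul, Real.norm_eq_abs,
    abs_of_pos (inv_pos.2 hL)] at h1
  have e2 : inner ℝ (gradient f x) w - inner ℝ (gradient f y) w = ‖w‖ ^ 2 := by
    rw [← inner_sub_left, ← hw, real_inner_self_eq_norm_sq]
  have h3 : L⁻¹ * ‖w‖ ^ 2 - L / 2 * (L⁻¹ * ‖w‖) ^ 2 ≤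
      f x - f y - inner ℝ (gradient f y) (x - y) := by
    rw [← e2] at *
    linarith
  have h4 : ‖w‖ ^ 2 = 2 * L * (L⁻¹ * ‖w‖ ^ 2 - L / 2 * (L⁻¹ * ‖w‖) ^ 2) := by
    field_simp
    ring
  rw [h4]
  gcongr

lemma fd_norm4 (a b c e : EuclideanSpace ℝ (Fin d)) :
    ‖a + b + c + e‖ ^ 2 ≤ 4 * (‖a‖ ^ 2 + ‖b‖ ^ 2 + ‖c‖ ^ 2 + ‖e‖ ^ 2) := by
  have h1 : ‖a + b + c + e‖ ≤ ‖a‖ + ‖b‖ + ‖c‖ + ‖e‖ := norm_add₄_le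
  have h2 := pow_le_pow_left₀ (norm_nonneg _) h1 2
  nlinarith [sq_nonneg (‖a‖ - ‖b‖), sq_nonneg (‖a‖ - ‖c‖), sq_nonneg (‖a‖ - ‖e‖),
    sq_nonneg (‖b‖ - ‖c‖), sq_nonneg (‖b‖ - ‖e‖), sq_nonneg (‖c‖ - ‖e‖)]

end Helpers

/-- FedDynOne bound on device dispersion, convex case. -/
theorem feddynone_device_dispersion_convex
    (d m : ℕ) (hd : 1 ≤ d) (hm : 1 ≤ m)
    (α L : ℝ) (hα : 0 < α) (hL : 0 < L)
    (Lk : Fin m → EuclideanSpace ℝ (Fin d) → ℝ)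
    (hdiff : ∀ k, Differentiable ℝ (Lk k))
    (hconv : ∀ k, ConvexOn ℝ Set.univ (Lk k))
    (hsmooth : ∀ k x y, ‖gradient (Lk k) x - gradient (Lk k) y‖ ≤ L * ‖x - y‖)
    (ℓ : EuclideanSpace ℝ (Fin d) → ℝ)
    (hℓ : ∀ θ, ℓ θ = (m : ℝ)⁻¹ * ∑ k, Lk k θ)
    (θstar : EuclideanSpace ℝ (Fin d)) (hmin : ∀ θ, ℓ θstar ≤ ℓ θ)
    (θbar : EuclideanSpace ℝ (Fin d))
    (hk : Fin m → EuclideanSpace ℝ (Fin d))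
    (h : EuclideanSpace ℝ (Fin d)) (hh : h = (m : ℝ)⁻¹ • ∑ k, hk k)
    (γbar : EuclideanSpace ℝ (Fin d)) (hγbar : γbar = θbar + α⁻¹ • h)
    (θt : Fin m → EuclideanSpace ℝ (Fin d))
    (hupd : ∀ k, θt k = θbar - α⁻¹ • (gradient (Lk k) θbar - hk k)) :
    (m : ℝ)⁻¹ * ∑ k, ‖θt k - γbar‖ ^ 2 ≤
      (8 / α ^ 2 + 4 * L ^ 2 / α ^ 4) *
        ((m : ℝ)⁻¹ * ∑ k, ‖hk k - gradient (Lk k) θstar‖ ^ 2) +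
      8 * L / α ^ 2 * (ℓ γbar - ℓ θstar) := by
  have hm0 : (0:ℝ) < m := by exact_mod_cast hm
  -- stationarity
  have hstat : ∑ k, gradient (Lk k) θstar = 0 := by
    set v := ∑ k, gradient (Lk k) θstar with hv
    have hder : HasDerivAt (fun t : ℝ => ∑ k, Lk k (θstar + t • v))
        (∑ k, inner ℝ (gradient (Lk k) (θstar + (0:ℝ) • v)) v) 0 :=
      HasDerivAt.fun_sum fun k _ => fd_line_deriv (Lk k) (hdiff k) θstar v 0
    have hloc : IsLocalMin (fun t : ℝ => ∑ k, Lk k (θstar + t • v)) 0 := by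
      refine Filter.Eventually.of_forall fun t => ?_
      have := hmin (θstar + t • v)
      rw [hℓ, hℓ] at this
      have := le_of_mul_le_mul_left this (inv_pos.2 hm0)
      simpa using this
    have h0 := hloc.hasDerivAt_eq_zero hder
    simp only [zero_smul, add_zero] at h0
    rw [← sum_inner, ← hv] at h0
    exact inner_self_eq_zero.1 h0
  set A := ∑ k, ‖hk k - gradient (Lk k) θstar‖ ^ 2 with hA
  have hhA : ‖h‖ ^ 2 ≤ (m : ℝ)⁻¹ * A := by
    have e : h = (m : ℝ)⁻¹ • ∑ k, (hk k - gradient (Lk k) θstar) := by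
      rw [Finset.sum_sub_distrib, hstat, sub_zero, hh]
    have h1 : ‖∑ k, (hk k - gradient (Lk k) θstar)‖ ^ 2 ≤ m * A := by
      refine (pow_le_pow_left₀ (norm_nonneg _) (norm_sum_le _ _) 2).trans ?_
      simpa using sq_sum_le_card_mul_sum_sq (s := Finset.univ)
        (f := fun k => ‖hk k - gradient (Lk k) θstar‖)
    rw [e, norm_smul, Real.norm_eq_abs, abs_of_pos (inv_pos.2 hm0), mul_pow]
    calc ((m:ℝ)⁻¹) ^ 2 * ‖∑ k, (hk k - gradient (Lk k) θstar)‖ ^ 2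
        ≤ ((m:ℝ)⁻¹) ^ 2 * (m * A) := by gcongr
      _ = (m : ℝ)⁻¹ * A := by field_simp
  have hterm : ∀ k, ‖θt k - γbar‖ ^ 2 ≤ 4 / α ^ 2 * (‖hk k - gradient (Lk k) θstar‖ ^ 2
      + ‖h‖ ^ 2 + 2 * L * (Lk k γbar - Lk k θstar
        - inner ℝ (gradient (Lk k) θstar) (γbar - θstar)) + L ^ 2 / α ^ 2 * ‖h‖ ^ 2) := by
    intro k
    have e : θt k - γbar = α⁻¹ • ((hk k - gradient (Lk k) θstar) + (-h)
        + (-(gradient (Lk k) γbar - gradient (Lk k) θstar))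
        + (gradient (Lk k) γbar - gradient (Lk k) θbar)) := by
      have e' : θt k - γbar = α⁻¹ • (hk k - gradient (Lk k) θbar - h) := by
        rw [hupd]
        nth_rewrite 1 [hγbar]
        module
      rw [e']
      congr 1
      abel
    have h4 := fd_norm4 (hk k - gradient (Lk k) θstar) (-h)
      (-(gradient (Lk k) γbar - gradient (Lk k) θstar))
      (gradient (Lk k) γbar - gradient (Lk k) θbar)
    rw [norm_neg, norm_neg] at h4
    have h5 := fd_cocoercive (Lk k) (hdiff k) (hconv k) L hL (hsmooth k) γbar θstar
    have h6 : ‖gradient (Lk k) γbar - gradient (Lk k) θbar‖ ^ 2 ≤ L ^ 2 / α ^ 2 * ‖h‖ ^ 2 := by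
      have h7 := pow_le_pow_left₀ (norm_nonneg _) (hsmooth k γbar θbar) 2
      have e7 : γbar - θbar = α⁻¹ • h := by rw [hγbar]; abel
      rw [e7, norm_smul, Real.norm_eq_abs, abs_of_pos (inv_pos.2 hα)] at h7
      refine h7.trans (le_of_eq ?_)
      field_simp
    rw [e, norm_smul, Real.norm_eq_abs, abs_of_pos (inv_pos.2 hα), mul_pow]
    have e8 : 4 / α ^ 2 = (α⁻¹) ^ 2 * 4 := by field_simp
    rw [e8, mul_assoc]
    refine mul_le_mul_of_nonneg_left ?_ (by positivity)
    linarith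
  have hin : ∑ k, inner ℝ (gradient (Lk k) θstar) (γbar - θstar) = 0 := by
    rw [← sum_inner, hstat, inner_zero_left]
  have hsum := Finset.sum_le_sum fun k (_ : k ∈ Finset.univ) => hterm k
  rw [← Finset.mul_sum, Finset.sum_add_distrib, Finset.sum_add_distrib, Finset.sum_add_distrib,
    ← Finset.mul_sum, Finset.sum_sub_distrib, Finset.sum_sub_distrib, hin, ← hA] at hsum
  simp only [Finset.sum_const, Finset.card_univ, Fintype.card_fin, nsmul_eq_mul] at hsum
  have hfin := mul_le_mul_of_nonneg_left hsum (inv_pos.2 hm0).le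
  refine hfin.trans ?_
  rw [hℓ, hℓ]
  set B := ∑ k, Lk k γbar
  set C := ∑ k, Lk k θstar
  have e9 : (m : ℝ)⁻¹ * (4 / α ^ 2 * (A + m * ‖h‖ ^ 2 + 2 * L * (B - C - 0)
      + m * (L ^ 2 / α ^ 2 * ‖h‖ ^ 2))) = 4 / α ^ 2 * ((m : ℝ)⁻¹ * A)
      + (4 / α ^ 2 + 4 * L ^ 2 / α ^ 4) * ‖h‖ ^ 2
      + 8 * L / α ^ 2 * ((m : ℝ)⁻¹ * B - (m : ℝ)⁻¹ * C) := by
    field_simp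
    ring
  rw [e9]
  have h10 := mul_le_mul_of_nonneg_left hhA
    (by positivity : 0 ≤ 4 / α ^ 2 + 4 * L ^ 2 / α ^ 4)
  have e11 : (8 / α ^ 2 + 4 * L ^ 2 / α ^ 4) * ((m : ℝ)⁻¹ * A) = 4 / α ^ 2 * ((m : ℝ)⁻¹ * A)
      + (4 / α ^ 2 + 4 * L ^ 2 / α ^ 4) * ((m : ℝ)⁻¹ * A) := by ring
  rw [e11]
  linarith
end

section
/- (Lemma: FedDynOne one-round contraction of the control-variate error, convex case.) With A = (1/m) ∑_{k=1}^m ‖h_k − ∇L_k(θ*)‖² and A⁺(𝒫) = (1/m)·( ∑_{k∈𝒫} ‖∇L_k(θ̄) − ∇L_k(θ*)‖² + ∑_{k∉𝒫} ‖h_k − ∇L_k(θ*)‖² ), the inequality E_𝒫[ A⁺(𝒫) ] ≤ ( 1 − P/m + (P/m)·(2L²/α²) )·A + 4L·(P/m)·( ℓ(γ̄) − ℓ(θ*) ) holds. -/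
open scoped RealInnerProductSpace

namespace FedAux

variable {E : Type*} [NormedAddCommGroup E] [InnerProductSpace ℝ E] [CompleteSpace E]

lemma line_deriv {f : E → ℝ} (hf : Differentiable ℝ f) (x v : E) (t : ℝ) :
    HasDerivAt (fun s : ℝ => f (x + s • v)) ⟪gradient f (x + t • v), v⟫ t := by
  have h1 : HasDerivAt (fun s : ℝ => x + s • v) v t := by
    simpa using ((hasDerivAt_id t).smul_const v).const_add x
  have h2 := (hf (x + t • v)).hasFDerivAt.comp_hasDerivAt t h1
  rw [inner_gradient_left]
  exact h2

lemma first_order {f : E → ℝ} (hf : Differentiable ℝ f) (hc : ConvexOn ℝ Set.univ f) (x y : E) :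
    f x + ⟪gradient f x, y - x⟫ ≤ f y := by
  have hc' : ConvexOn ℝ Set.univ (fun s : ℝ => f (x + s • (y - x))) := by
    refine ⟨convex_univ, fun a _ b _ p q hp hq hpq => ?_⟩
    have := hc.2 (Set.mem_univ (x + a • (y - x))) (Set.mem_univ (x + b • (y - x))) hp hq hpq
    have e : x + (p • a + q • b) • (y - x) = p • (x + a • (y - x)) + q • (x + b • (y - x)) := by
      have : x = (p + q) • x := by rw [hpq, one_smul]
      nth_rewrite 1 [this]
      simp only [smul_eq_mul]
      module
    simp only [e]
    exact this
  have h := hc'.le_slope_of_hasDerivAt (Set.mem_univ 0) (Set.mem_univ 1) one_pos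
    (line_deriv hf x (y - x) 0)
  simp [slope_def_field] at h
  rw [inner_gradient_left, map_sub]
  linarith

lemma descent {f : E → ℝ} (hf : Differentiable ℝ f) {L : ℝ}
    (hs : ∀ x y, ‖gradient f x - gradient f y‖ ≤ L * ‖x - y‖) (x v : E) :
    f (x + v) ≤ f x + ⟪gradient f x, v⟫ + L / 2 * ‖v‖ ^ 2 := by
  have hd : ∀ t : ℝ, HasDerivAt
      (fun s : ℝ => f (x + s • v) - s * ⟪gradient f x, v⟫ - s ^ 2 * (L / 2 * ‖v‖ ^ 2))
      (⟪gradient f (x + t • v), v⟫ - ⟪gradient f x, v⟫ - t * (L * ‖v‖ ^ 2)) t := by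
    intro t
    have := ((line_deriv hf x v t).sub ((hasDerivAt_id t).mul_const ⟪gradient f x, v⟫)).sub
      ((hasDerivAt_pow 2 t).mul_const (L / 2 * ‖v‖ ^ 2))
    convert! this using 1
    simp
    ring
  have hanti := antitoneOn_of_deriv_nonpos (convex_Icc (0:ℝ) 1)
    (fun t _ => (hd t).continuousAt.continuousWithinAt)
    (fun t _ => (hd t).differentiableAt.differentiableWithinAt)
    (fun t ht => by
      rw [interior_Icc] at ht
      rw [(hd t).deriv, ← inner_sub_left]
      have h1 := real_inner_le_norm (gradient f (x + t • v) - gradient f x) v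
      have h2 := hs (x + t • v) x
      rw [add_sub_cancel_left, norm_smul, Real.norm_of_nonneg ht.1.le] at h2
      have h3 := mul_le_mul_of_nonneg_right h2 (norm_nonneg v)
      nlinarith)
  have := hanti (Set.left_mem_Icc.2 zero_le_one) (Set.right_mem_Icc.2 zero_le_one) zero_le_one
  simp at this
  rw [inner_gradient_left]
  linarith

lemma coco {f : E → ℝ} (hf : Differentiable ℝ f) (hc : ConvexOn ℝ Set.univ f) {L : ℝ} (hL : 0 < L)
    (hs : ∀ x y, ‖gradient f x - gradient f y‖ ≤ L * ‖x - y‖) (x y : E) :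
    ‖gradient f y - gradient f x‖ ^ 2 ≤ 2 * L * (f y - f x - ⟪gradient f x, y - x⟫) := by
  set w := gradient f y - gradient f x with hw
  have h1 := first_order hf hc x (y + (-L⁻¹) • w)
  have h2 := descent hf hs y ((-L⁻¹) • w)
  have e : y + (-L⁻¹) • w - x = (y - x) + (-L⁻¹) • w := by abel
  rw [e, inner_add_right, inner_smul_right] at h1
  rw [inner_smul_right, norm_smul, mul_pow, norm_neg, norm_inv, Real.norm_of_nonneg hL.le] at h2
  have h3 : ⟪gradient f y, w⟫ - ⟪gradient f x, w⟫ = ‖w‖ ^ 2 := by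
    rw [← inner_sub_left, ← hw, real_inner_self_eq_norm_sq]
  have h4 : L / 2 * (L⁻¹ ^ 2 * ‖w‖ ^ 2) = L⁻¹ * ‖w‖ ^ 2 / 2 := by field_simp
  have h5 : L⁻¹ * ‖w‖ ^ 2 ≤ 2 * (f y - f x - ⟪gradient f x, y - x⟫) := by
    have : L⁻¹ * ‖w‖ ^ 2 = L⁻¹ * ⟪gradient f y, w⟫ - L⁻¹ * ⟪gradient f x, w⟫ := by
      rw [← h3]; ring
    linarith
  have h6 := mul_le_mul_of_nonneg_left h5 hL.le
  rw [mul_inv_cancel_left₀ hL.ne'] at h6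
  linarith

lemma avg {m P : ℕ} (hP1 : 1 ≤ P) (hPm : P ≤ m) (a : Fin m → ℝ) :
    (∑ S ∈ Finset.powersetCard P (Finset.univ : Finset (Fin m)), ∑ k ∈ S, a k)
      = (m.choose P : ℝ) * ((P : ℝ) / m) * ∑ k, a k := by
  have h1 : ∀ S ∈ Finset.powersetCard P (Finset.univ : Finset (Fin m)),
      ∑ k ∈ S, a k = ∑ k, if k ∈ S then a k else 0 := by
    intro S _; simp
  rw [Finset.sum_congr rfl h1, Finset.sum_comm, Finset.mul_sum]
  refine Finset.sum_congr rfl fun k _ => ?_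
  rw [← Finset.sum_filter, Finset.sum_const, nsmul_eq_mul]
  congr 1
  have h2 := Finset.card_filter_powersetCard_subset {k} (Finset.univ : Finset (Fin m)) P
    (by simp) (by simpa using hP1)
  simp only [Finset.singleton_subset_iff, Finset.card_singleton, Finset.card_univ,
    Fintype.card_fin] at h2
  rw [h2]
  obtain ⟨p, rfl⟩ : ∃ p, P = p + 1 := ⟨P - 1, by omega⟩
  obtain ⟨n, rfl⟩ : ∃ n, m = n + 1 := ⟨m - 1, by omega⟩
  have h3 := Nat.add_one_mul_choose_eq n p
  have h4 : ((n : ℝ) + 1) * (n.choose p) = ((n + 1).choose (p + 1)) * ((p : ℝ) + 1) := by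
    exact_mod_cast h3
  simp only [Nat.add_sub_cancel]
  push_cast
  field_simp
  linarith

lemma norm_avg {m : ℕ} (hm : 1 ≤ m) (u : Fin m → E) :
    ‖(m : ℝ)⁻¹ • ∑ k, u k‖ ^ 2 ≤ (m : ℝ)⁻¹ * ∑ k, ‖u k‖ ^ 2 := by
  have hm' : (0 : ℝ) < m := by exact_mod_cast hm
  have h1 : ‖∑ k, u k‖ ^ 2 ≤ (m : ℝ) * ∑ k, ‖u k‖ ^ 2 := by
    calc ‖∑ k, u k‖ ^ 2 ≤ (∑ k, ‖u k‖) ^ 2 := by gcongr; exact norm_sum_le _ _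
      _ ≤ _ := by
        have := sq_sum_le_card_mul_sum_sq (s := (Finset.univ : Finset (Fin m)))
          (f := fun k => ‖u k‖)
        simpa using this
  rw [norm_smul, mul_pow, norm_inv, Real.norm_of_nonneg hm'.le]
  calc (m : ℝ)⁻¹ ^ 2 * ‖∑ k, u k‖ ^ 2 ≤ (m : ℝ)⁻¹ ^ 2 * ((m : ℝ) * ∑ k, ‖u k‖ ^ 2) := by gcongr
    _ = _ := by field_simp

end FedAux

/-- FedDynOne one-round contraction of the control-variate error, convex case. -/
theorem feddynone_control_variate_contraction_convex
    (d m P : ℕ) (hd : 1 ≤ d) (hm : 1 ≤ m) (hP1 : 1 ≤ P) (hPm : P ≤ m)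
    (α L : ℝ) (hα : 0 < α) (hL : 0 < L)
    (Lk : Fin m → EuclideanSpace ℝ (Fin d) → ℝ)
    (hdiff : ∀ k, Differentiable ℝ (Lk k))
    (hconv : ∀ k, ConvexOn ℝ Set.univ (Lk k))
    (hsmooth : ∀ k x y, ‖gradient (Lk k) x - gradient (Lk k) y‖ ≤ L * ‖x - y‖)
    (ℓ : EuclideanSpace ℝ (Fin d) → ℝ)
    (hℓ : ∀ θ, ℓ θ = (m : ℝ)⁻¹ * ∑ k, Lk k θ)
    (θstar : EuclideanSpace ℝ (Fin d)) (hmin : ∀ θ, ℓ θstar ≤ ℓ θ)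
    (θbar : EuclideanSpace ℝ (Fin d))
    (hk : Fin m → EuclideanSpace ℝ (Fin d))
    (h : EuclideanSpace ℝ (Fin d)) (hh : h = (m : ℝ)⁻¹ • ∑ k, hk k)
    (γbar : EuclideanSpace ℝ (Fin d)) (hγbar : γbar = θbar + α⁻¹ • h) :
    (∑ S ∈ Finset.powersetCard P (Finset.univ : Finset (Fin m)),
        (m : ℝ)⁻¹ * (∑ k ∈ S, ‖gradient (Lk k) θbar - gradient (Lk k) θstar‖ ^ 2 +
          ∑ k ∈ Sᶜ, ‖hk k - gradient (Lk k) θstar‖ ^ 2)) /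
      ((Finset.powersetCard P (Finset.univ : Finset (Fin m))).card : ℝ) ≤
    (1 - (P : ℝ) / m + (P : ℝ) / m * (2 * L ^ 2 / α ^ 2)) *
        ((m : ℝ)⁻¹ * ∑ k, ‖hk k - gradient (Lk k) θstar‖ ^ 2) +
      4 * L * ((P : ℝ) / m) * (ℓ γbar - ℓ θstar) := by
  have hm' : (0 : ℝ) < m := by exact_mod_cast hm
  -- the gradients sum to zero at the minimizer
  have hg : ∑ k, gradient (Lk k) θstar = 0 := by
    have hd1 : HasFDerivAt ℓ ((m : ℝ)⁻¹ • ∑ k, fderiv ℝ (Lk k) θstar) θstar := by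
      have : ℓ = fun θ => (m : ℝ)⁻¹ * ∑ k, Lk k θ := funext hℓ
      rw [this]
      exact (HasFDerivAt.fun_sum fun k _ => (hdiff k θstar).hasFDerivAt).const_mul _
    have hz : (m : ℝ)⁻¹ • ∑ k, fderiv ℝ (Lk k) θstar = 0 :=
      IsLocalMin.hasFDerivAt_eq_zero (Filter.Eventually.of_forall hmin) hd1
    have hz' : ∑ k, fderiv ℝ (Lk k) θstar = 0 :=
      (smul_eq_zero.1 hz).resolve_left (inv_ne_zero hm'.ne')
    apply (InnerProductSpace.toDual ℝ (EuclideanSpace ℝ (Fin d))).injective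
    rw [map_sum, map_zero, ← hz']
    exact Finset.sum_congr rfl fun k _ => toDual_gradient
  set a : Fin m → ℝ := fun k => ‖gradient (Lk k) θbar - gradient (Lk k) θstar‖ ^ 2 with ha
  set b : Fin m → ℝ := fun k => ‖hk k - gradient (Lk k) θstar‖ ^ 2 with hb
  have hh2 : ‖h‖ ^ 2 ≤ (m : ℝ)⁻¹ * ∑ k, b k := by
    have := FedAux.norm_avg hm (fun k => hk k - gradient (Lk k) θstar)
    rw [Finset.sum_sub_distrib, hg, sub_zero, ← hh] at this
    exact this
  have hak : ∀ k, a k ≤ 2 * L ^ 2 / α ^ 2 * ‖h‖ ^ 2 +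
      4 * L * (Lk k γbar - Lk k θstar - ⟪gradient (Lk k) θstar, γbar - θstar⟫) := by
    intro k
    have h1 := FedAux.coco (hdiff k) (hconv k) hL (hsmooth k) θstar γbar
    have h2 := hsmooth k θbar γbar
    have h3 : ‖θbar - γbar‖ = α⁻¹ * ‖h‖ := by
      rw [hγbar, sub_add_cancel_left, norm_neg, norm_smul, norm_inv, Real.norm_of_nonneg hα.le]
    rw [h3] at h2
    have h4 : ‖gradient (Lk k) θbar - gradient (Lk k) θstar‖ ≤
        ‖gradient (Lk k) θbar - gradient (Lk k) γbar‖ +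
        ‖gradient (Lk k) γbar - gradient (Lk k) θstar‖ := norm_sub_le_norm_sub_add_norm_sub _ _ _
    have h5 : ‖gradient (Lk k) θbar - gradient (Lk k) γbar‖ ^ 2 ≤ L ^ 2 / α ^ 2 * ‖h‖ ^ 2 := by
      calc _ ≤ (L * (α⁻¹ * ‖h‖)) ^ 2 := by gcongr
        _ = _ := by field_simp
    have h6 : a k ≤ (‖gradient (Lk k) θbar - gradient (Lk k) γbar‖ +
        ‖gradient (Lk k) γbar - gradient (Lk k) θstar‖) ^ 2 := by
      simp only [ha]; gcongr
    have h7 := add_sq_le (a := ‖gradient (Lk k) θbar - gradient (Lk k) γbar‖)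
      (b := ‖gradient (Lk k) γbar - gradient (Lk k) θstar‖)
    have h8 : 2 * L ^ 2 / α ^ 2 * ‖h‖ ^ 2 = 2 * (L ^ 2 / α ^ 2 * ‖h‖ ^ 2) := by ring
    linarith
  have hA : (m : ℝ)⁻¹ * ∑ k, a k ≤ 2 * L ^ 2 / α ^ 2 * ((m : ℝ)⁻¹ * ∑ k, b k) +
      4 * L * (ℓ γbar - ℓ θstar) := by
    have h1 : ∑ k, a k ≤ m * (2 * L ^ 2 / α ^ 2 * ‖h‖ ^ 2) +
        4 * L * (∑ k, Lk k γbar - ∑ k, Lk k θstar) := by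
      refine (Finset.sum_le_sum fun k _ => hak k).trans (le_of_eq ?_)
      rw [Finset.sum_add_distrib, Finset.sum_const, ← Finset.mul_sum, Finset.sum_sub_distrib,
        Finset.sum_sub_distrib, ← sum_inner, hg, inner_zero_left]
      simp
    have h2 := mul_le_mul_of_nonneg_left h1 (inv_nonneg.2 hm'.le)
    have h3 : (m : ℝ)⁻¹ * (m * (2 * L ^ 2 / α ^ 2 * ‖h‖ ^ 2) +
        4 * L * (∑ k, Lk k γbar - ∑ k, Lk k θstar)) = 2 * L ^ 2 / α ^ 2 * ‖h‖ ^ 2 +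
        4 * L * (ℓ γbar - ℓ θstar) := by
      rw [hℓ, hℓ]; field_simp
    rw [h3] at h2
    refine h2.trans ?_
    gcongr
  have hC : (0 : ℝ) < m.choose P := by exact_mod_cast Nat.choose_pos hPm
  have hE : (∑ S ∈ Finset.powersetCard P (Finset.univ : Finset (Fin m)),
        (m : ℝ)⁻¹ * (∑ k ∈ S, a k + ∑ k ∈ Sᶜ, b k)) /
      ((Finset.powersetCard P (Finset.univ : Finset (Fin m))).card : ℝ) =
      (P : ℝ) / m * ((m : ℝ)⁻¹ * ∑ k, a k) + (1 - (P : ℝ) / m) * ((m : ℝ)⁻¹ * ∑ k, b k) := by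
    have hc : ∀ S : Finset (Fin m), ∑ k ∈ Sᶜ, b k = ∑ k, b k - ∑ k ∈ S, b k := fun S => by
      rw [← Finset.sum_add_sum_compl S b]; ring
    simp only [hc]
    rw [← Finset.mul_sum, Finset.sum_add_distrib, Finset.sum_sub_distrib, FedAux.avg hP1 hPm,
      FedAux.avg hP1 hPm, Finset.sum_const, nsmul_eq_mul, Finset.card_powersetCard,
      Finset.card_univ, Fintype.card_fin]
    field_simp
  rw [hE]
  have hPm0 : 0 ≤ (P : ℝ) / m := by positivity
  have := mul_le_mul_of_nonneg_left hA hPm0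
  linarith
end

section
/- (Lemma: FedDynOne gradient-deviation bound, nonconvex case.) With B = (1/m) ∑_{k=1}^m ‖h_k − ∇L_k(γ̄)‖², the inequality (1/m) ∑_{k=1}^m ‖∇L_k(γ̄) − ∇L_k(θ̄)‖² ≤ (2L²/α²)·B + (2L²/α²)·‖∇ℓ(γ̄)‖² holds. -/
open scoped RealInnerProductSpace

/-- FedDynOne gradient-deviation bound, nonconvex case. -/
theorem feddynone_gradient_deviation_nonconvex
    (d m : ℕ) (hd : 1 ≤ d) (hm : 1 ≤ m)
    (α L : ℝ) (hα : 0 < α) (hL : 0 < L)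
    (Lk : Fin m → EuclideanSpace ℝ (Fin d) → ℝ)
    (hdiff : ∀ k, Differentiable ℝ (Lk k))
    (hsmooth : ∀ k x y, ‖gradient (Lk k) x - gradient (Lk k) y‖ ≤ L * ‖x - y‖)
    (ℓ : EuclideanSpace ℝ (Fin d) → ℝ)
    (hℓ : ∀ θ, ℓ θ = (m : ℝ)⁻¹ * ∑ k, Lk k θ)
    (θbar : EuclideanSpace ℝ (Fin d))
    (hk : Fin m → EuclideanSpace ℝ (Fin d))
    (h : EuclideanSpace ℝ (Fin d)) (hh : h = (m : ℝ)⁻¹ • ∑ k, hk k)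
    (γbar : EuclideanSpace ℝ (Fin d)) (hγbar : γbar = θbar + α⁻¹ • h) :
    (m : ℝ)⁻¹ * ∑ k, ‖gradient (Lk k) γbar - gradient (Lk k) θbar‖ ^ 2 ≤
      2 * L ^ 2 / α ^ 2 * ((m : ℝ)⁻¹ * ∑ k, ‖hk k - gradient (Lk k) γbar‖ ^ 2) +
      2 * L ^ 2 / α ^ 2 * ‖gradient ℓ γbar‖ ^ 2 := by
  have hm0 : (0 : ℝ) < m := by exact_mod_cast hm
  have hgrad : gradient ℓ γbar = (m : ℝ)⁻¹ • ∑ k, gradient (Lk k) γbar := by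
    have hf : ℓ = fun θ => (m : ℝ)⁻¹ * ∑ k, Lk k θ := funext hℓ
    have h1 : HasFDerivAt (fun θ => ∑ k, Lk k θ) (∑ k, fderiv ℝ (Lk k) γbar) γbar :=
      HasFDerivAt.fun_sum fun k _ => (hdiff k γbar).hasFDerivAt
    have h2 := (h1.const_mul (m : ℝ)⁻¹).fderiv
    rw [hf]
    unfold gradient
    rw [h2]
    simp [map_sum]
  set g : Fin m → EuclideanSpace ℝ (Fin d) := fun k => gradient (Lk k) γbar with hg
  set G := gradient ℓ γbar with hG
  set v : EuclideanSpace ℝ (Fin d) := (m : ℝ)⁻¹ • ∑ k, (hk k - g k) with hv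
  have hsum : h = v + G := by
    rw [hh, hgrad, hv, Finset.sum_sub_distrib, smul_sub]
    simp [hg]
  set S := ∑ k, ‖hk k - g k‖ ^ 2 with hS
  have hvn : ‖v‖ ^ 2 ≤ (m : ℝ)⁻¹ * S := by
    have h1 : ‖∑ k, (hk k - g k)‖ ≤ ∑ k, ‖hk k - g k‖ := norm_sum_le _ _
    have h2 : (∑ k, ‖hk k - g k‖) ^ 2 ≤ (m : ℝ) * S := by
      have := sq_sum_le_card_mul_sum_sq (s := Finset.univ) (f := fun k => ‖hk k - g k‖)
      simpa using this
    have h3 : ‖∑ k, (hk k - g k)‖ ^ 2 ≤ (m : ℝ) * S :=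
      (pow_le_pow_left₀ (norm_nonneg _) h1 2).trans h2
    rw [hv, norm_smul, mul_pow, Real.norm_of_nonneg (by positivity)]
    calc ((m : ℝ)⁻¹) ^ 2 * ‖∑ k, (hk k - g k)‖ ^ 2 ≤ ((m : ℝ)⁻¹) ^ 2 * ((m : ℝ) * S) := by gcongr
      _ = (m : ℝ)⁻¹ * S := by field_simp
  have hhn : ‖h‖ ^ 2 ≤ 2 * ((m : ℝ)⁻¹ * S) + 2 * ‖G‖ ^ 2 := by
    have h1 : ‖h‖ ≤ ‖v‖ + ‖G‖ := hsum ▸ norm_add_le v G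
    have h2 := pow_le_pow_left₀ (norm_nonneg _) h1 2
    nlinarith [sq_nonneg (‖v‖ - ‖G‖)]
  have hterm : ∀ k, ‖g k - gradient (Lk k) θbar‖ ^ 2 ≤ L ^ 2 / α ^ 2 * ‖h‖ ^ 2 := by
    intro k
    have h1 := pow_le_pow_left₀ (norm_nonneg _) (hsmooth k γbar θbar) 2
    have h2 : ‖γbar - θbar‖ = α⁻¹ * ‖h‖ := by
      rw [hγbar, add_sub_cancel_left, norm_smul, Real.norm_of_nonneg (by positivity)]
    rw [h2] at h1
    refine h1.trans (le_of_eq ?_)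
    field_simp
  have hA : (m : ℝ)⁻¹ * ∑ k, ‖g k - gradient (Lk k) θbar‖ ^ 2 ≤ L ^ 2 / α ^ 2 * ‖h‖ ^ 2 := by
    have h1 := Finset.sum_le_sum fun k (_ : k ∈ Finset.univ) => hterm k
    rw [Finset.sum_const, Finset.card_univ, Fintype.card_fin, nsmul_eq_mul] at h1
    rw [inv_mul_le_iff₀ hm0]
    exact h1
  refine hA.trans ?_
  calc L ^ 2 / α ^ 2 * ‖h‖ ^ 2 ≤ L ^ 2 / α ^ 2 * (2 * ((m : ℝ)⁻¹ * S) + 2 * ‖G‖ ^ 2) := by gcongr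
    _ = _ := by ring
end
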